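/- arXiv:2508.08070 — 4 statements merged into one kernel-verified Lean document; each statement's English description precedes it below -/
import Mathlib

section
/- Let p > 2 and k be distinct primes, and let q = p^r for some r ≥ 1. Let Ω ∈ GL_{2k}(F_q) be an invertible matrix with Ωᵀ = −Ω (so that Ω defines a symplectic form on F_q^{2k}), and set K := Sp_{2k}(F_q, Ω) = {Y ∈ GL_{2k}(F_q) : YᵀΩY = Ω}. Let X be a subgroup of SL_{2k}(F_q) such that K is a normal subgroup of X, and suppose X is generated by a set of elements each of whose orders is a power of p. Then X = K. -/
open Matrix

section Symplectic

variable {n F : Type*} [Fintype n] [Field F]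

theorem Matrix.dotProduct_mulVec_self_eq_zero {Ω : Matrix n n F} (h2 : (2 : F) ≠ 0)
    (hΩ : Ωᵀ = -Ω) (v : n → F) : v ⬝ᵥ Ω *ᵥ v = 0 := by
  have h : v ⬝ᵥ Ω *ᵥ v = -(v ⬝ᵥ Ω *ᵥ v) := by
    conv_lhs => rw [dotProduct_comm, ← vecMul_transpose, hΩ, ← dotProduct_mulVec, neg_mulVec,
      dotProduct_neg]
  have h' : 2 * (v ⬝ᵥ Ω *ᵥ v) = 0 := by linear_combination h
  exact (mul_eq_zero.mp h').resolve_left h2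

theorem Matrix.isometry_mul_mul_of_semiconj {Ω s t g : Matrix n n F} (hs : sᵀ * Ω * s = Ω)
    (h : s * t = t * g) : gᵀ * (tᵀ * Ω * t) * g = tᵀ * Ω * t := by
  calc gᵀ * (tᵀ * Ω * t) * g = (t * g)ᵀ * Ω * (t * g) := by
        rw [transpose_mul]; simp only [Matrix.mul_assoc]
    _ = tᵀ * (sᵀ * Ω * s) * t := by
        rw [← h, transpose_mul]; simp only [Matrix.mul_assoc]
    _ = tᵀ * Ω * t := by rw [hs]

variable [DecidableEq n]

/-- An endomorphism stabilizing every line is a homothety, in matrix form. -/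
theorem Matrix.exists_eq_smul_one_of_forall_mulVec {M : Matrix n n F}
    (h : ∀ v : n → F, ∃ a : F, M *ᵥ v = a • v) : ∃ c : F, M = c • (1 : Matrix n n F) := by
  obtain ⟨c, hc⟩ :=
    LinearMap.exists_eq_smul_id_of_forall_notLinearIndependent (f := Matrix.toLin' M) (by
      intro v hv
      obtain ⟨a, ha⟩ := h v
      have := (LinearIndependent.pair_iff.mp hv) a (-1) (by simp [ha])
      simp at this)
  refine ⟨c, ?_⟩
  apply Matrix.toLin'.injective
  rw [hc, map_smul, Matrix.toLin'_one, Module.End.one_eq_id]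

/-- Symplectic transvections are isometries. -/
theorem Matrix.transvection_isometry {Ω : Matrix n n F} (h2 : (2 : F) ≠ 0) (hΩ : Ωᵀ = -Ω)
    (v : n → F) :
    (1 + vecMulVec v (v ᵥ* Ω))ᵀ * Ω * (1 + vecMulVec v (v ᵥ* Ω)) = Ω := by
  have hT : (vecMulVec v (v ᵥ* Ω))ᵀ = -vecMulVec (Ω *ᵥ v) v := by
    rw [transpose_vecMulVec, ← mulVec_transpose, hΩ, neg_mulVec, neg_vecMulVec]
  have hv : v ᵥ* Ω ⬝ᵥ v = 0 := by
    rw [← dotProduct_mulVec, dotProduct_mulVec_self_eq_zero h2 hΩ]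
  rw [transpose_add, transpose_one, hT]
  simp only [add_mul, mul_add, neg_mul, one_mul, mul_one, mul_vecMulVec, vecMulVec_mul,
    vecMulVec_mulVec, hv, MulOpposite.op_zero, zero_smul, zero_vecMulVec]
  abel

theorem Matrix.isUnit_of_isometry {Ω A : Matrix n n F} (hΩ : IsUnit Ω)
    (h : Aᵀ * Ω * A = Ω) : IsUnit A := by
  rw [← h] at hΩ
  rw [isUnit_iff_isUnit_det, det_mul] at hΩ
  exact (isUnit_iff_isUnit_det A).mpr (isUnit_of_mul_isUnit_right hΩ)

/-- Any bilinear form invariant under the isometry group of a symplectic form is a multiple of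
that form. -/
theorem Matrix.exists_eq_smul_of_isometry_invariant {Ω B : Matrix n n F} (h2 : (2 : F) ≠ 0)
    (hΩu : IsUnit Ω) (hΩ : Ωᵀ = -Ω)
    (hB : ∀ A : Matrix n n F, Aᵀ * Ω * A = Ω → Aᵀ * B * A = B) : ∃ c : F, B = c • Ω := by
  have hdet := (isUnit_iff_isUnit_det Ω).mp hΩu
  have hcomm : ∀ A : Matrix n n F, Aᵀ * Ω * A = Ω → Ω⁻¹ * B * A = A * (Ω⁻¹ * B) := by
    intro A hA
    have hAu := (isUnit_iff_isUnit_det Aᵀ).mp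
      (isUnit_transpose A |>.mpr (isUnit_of_isometry hΩu hA))
    have key : Aᵀ * (Ω * (Ω⁻¹ * B * A)) = Aᵀ * (Ω * (A * (Ω⁻¹ * B))) := by
      calc Aᵀ * (Ω * (Ω⁻¹ * B * A)) = Aᵀ * (Ω * Ω⁻¹) * B * A := by simp only [mul_assoc]
        _ = B := by rw [mul_nonsing_inv _ hdet, mul_one, hB A hA]
        _ = Ω * Ω⁻¹ * B := by rw [mul_nonsing_inv _ hdet, one_mul]
        _ = Aᵀ * Ω * A * Ω⁻¹ * B := by rw [hA]
        _ = _ := by simp only [mul_assoc]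
    have := congrArg (fun Z => Ω⁻¹ * ((Aᵀ)⁻¹ * Z)) key
    simpa only [nonsing_inv_mul_cancel_left _ _ hAu, nonsing_inv_mul_cancel_left _ _ hdet]
      using this
  obtain ⟨c, hc⟩ := exists_eq_smul_one_of_forall_mulVec (M := Ω⁻¹ * B) (by
    intro v
    by_cases hv : v = 0
    · exact ⟨0, by simp [hv]⟩
    have hw : v ᵥ* Ω ≠ 0 := fun h0 => hv <| by
      have := congrArg (· ᵥ* Ω⁻¹) h0
      simpa [vecMul_vecMul, mul_nonsing_inv _ hdet] using this
    obtain ⟨j, hj⟩ := Function.ne_iff.mp hw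
    have h := hcomm _ (transvection_isometry h2 hΩ v)
    rw [mul_add, add_mul, mul_one, one_mul, add_right_inj, mul_vecMulVec, vecMulVec_mul] at h
    refine ⟨((v ᵥ* Ω) ᵥ* (Ω⁻¹ * B)) j / (v ᵥ* Ω) j, funext fun i => ?_⟩
    have hij := congrFun (congrFun h i) j
    rw [vecMulVec_apply, vecMulVec_apply] at hij
    simp only [Pi.zero_apply] at hj
    rw [Pi.smul_apply, smul_eq_mul, div_mul_eq_mul_div, eq_div_iff hj, hij, mul_comm])
  refine ⟨c, ?_⟩
  rw [← mul_nonsing_inv_cancel_left Ω B hdet, hc, Matrix.mul_smul, mul_one]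

theorem Matrix.transpose_pow_mul_mul_pow {Ω A : Matrix n n F} {c : F}
    (h : Aᵀ * Ω * A = c • Ω) (m : ℕ) : (A ^ m)ᵀ * Ω * A ^ m = c ^ m • Ω := by
  induction m with
  | zero => simp
  | succ m ih =>
    calc (A ^ (m + 1))ᵀ * Ω * A ^ (m + 1) = Aᵀ * ((A ^ m)ᵀ * Ω * A ^ m) * A := by
          rw [pow_succ, transpose_mul]; simp only [mul_assoc]
      _ = c ^ (m + 1) • Ω := by
          rw [ih, Matrix.mul_smul, Matrix.smul_mul, h, smul_smul, pow_succ]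

end Symplectic

theorem stmt9 (p r q k : ℕ) (hp : p.Prime) (hk : k.Prime) (hp2 : 2 < p) (hpk : p ≠ k)
    (hr : 1 ≤ r) (hq : q = p ^ r)
    (F : Type) [Field F] [Fintype F] (hF : Fintype.card F = q)
    (Ω : Matrix (Fin 2 × Fin k) (Fin 2 × Fin k) F) (hΩu : IsUnit Ω) (hΩalt : Ωᵀ = -Ω)
    (K X : Subgroup (Matrix.SpecialLinearGroup (Fin 2 × Fin k) F))
    -- `K` is the symplectic group `Sp_{2k}(F, Ω) = {Y ∈ GL : Yᵀ Ω Y = Ω}`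
    (hK : (fun g : Matrix.SpecialLinearGroup (Fin 2 × Fin k) F =>
            (g : Matrix (Fin 2 × Fin k) (Fin 2 × Fin k) F)) ''
          (K : Set (Matrix.SpecialLinearGroup (Fin 2 × Fin k) F)) =
        {A : Matrix (Fin 2 × Fin k) (Fin 2 × Fin k) F | IsUnit A ∧ Aᵀ * Ω * A = Ω})
    -- `K` is a normal subgroup of `X`
    (hKX : K ≤ X) (hnorm : (K.subgroupOf X).Normal)
    -- `X` is generated by a set of elements of `p`-power order
    (hgen : ∃ T : Set (Matrix.SpecialLinearGroup (Fin 2 × Fin k) F),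
      X = Subgroup.closure T ∧ ∀ t ∈ T, ∃ m : ℕ, orderOf t = p ^ m) :
    X = K := by
  have : Fact p.Prime := ⟨hp⟩
  have : CharP F p := charP_of_card_eq_prime_pow (hF.trans hq)
  have h2 : (2 : F) ≠ 0 := Ring.two_ne_zero (by rw [ringChar.eq F p]; omega)
  have : NeZero k := ⟨hk.ne_zero⟩
  have hmem : ∀ g : Matrix.SpecialLinearGroup (Fin 2 × Fin k) F,
      g ∈ K ↔ (g : Matrix (Fin 2 × Fin k) (Fin 2 × Fin k) F)ᵀ * Ω * g = Ω := by
    intro g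
    constructor
    · intro hg
      exact (hK.subset ⟨g, hg, rfl⟩).2
    · intro hg
      obtain ⟨g', hg', he⟩ := hK.superset ⟨isUnit_of_isometry hΩu hg, hg⟩
      rwa [← Subtype.ext he]
  refine le_antisymm ?_ hKX
  obtain ⟨T, rfl, hT⟩ := hgen
  rw [Subgroup.closure_le]
  intro t ht
  obtain ⟨c, hc⟩ := exists_eq_smul_of_isometry_invariant h2 hΩu hΩalt
    (B := (t : Matrix (Fin 2 × Fin k) (Fin 2 × Fin k) F)ᵀ * Ω *
      (t : Matrix (Fin 2 × Fin k) (Fin 2 × Fin k) F)) (by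
      intro A hA
      obtain ⟨g, hg, rfl⟩ := hK.superset ⟨isUnit_of_isometry hΩu hA, hA⟩
      have hconj : t * g * t⁻¹ ∈ K :=
        hnorm.conj_mem ⟨g, hKX hg⟩ hg ⟨t, Subgroup.subset_closure ht⟩
      refine isometry_mul_mul_of_semiconj ((hmem _).mp hconj) ?_
      exact congrArg Subtype.val (inv_mul_cancel_right (t * g) t))
  obtain ⟨m, hm⟩ := hT t ht
  have hpow := transpose_pow_mul_mul_pow hc (p ^ m)
  rw [← Matrix.SpecialLinearGroup.coe_pow, ← hm, pow_orderOf_eq_one,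
    Matrix.SpecialLinearGroup.coe_one, transpose_one, one_mul, mul_one, hm] at hpow
  have hc1 : c ^ p ^ m = 1 := by
    have h0 : (c ^ p ^ m - 1) • Ω = 0 := by rw [sub_smul, one_smul, ← hpow, sub_self]
    exact sub_eq_zero.mp ((smul_eq_zero.mp h0).resolve_right hΩu.ne_zero)
  have hc' : c = 1 := iterateFrobenius_inj F p m (by simpa [iterateFrobenius_def] using hc1)
  exact (hmem t).mpr (by rw [hc, hc', one_smul])
end

section
/- Let q > 1 be a prime power and k ≥ 2 an integer, and let L be a field with q^k elements regarded as an extension of F_q. Suppose b ∈ L satisfies Tr_{L/F_q}(b) = 1. Then there exists a primitive element λ ∈ L (i.e. a generator of the cyclic group L^×) such that Tr_{L/F_q}(λb) ≠ 0. -/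
open Finset in
/-- A geometric sum `1 + Q + ⋯ + Q ^ (m - 1)` that is squarefree and all of whose prime factors
divide `Q - 1` has only one term. -/
lemma eq_one_of_squarefree_geom_sum {Q m : ℕ} (hQ : 2 ≤ Q) (hm : m ≠ 0)
    (hsq : Squarefree (∑ i ∈ range m, Q ^ i))
    (hdvd : ∀ p, p.Prime → p ∣ ∑ i ∈ range m, Q ^ i → p ∣ Q - 1) : m = 1 := by
  have hNm : ∑ i ∈ range m, Q ^ i ∣ m := by
    rw [← Nat.prod_primeFactors_of_squarefree hsq]
    refine (prod_dvd_prod_of_subset _ m.primeFactors _ fun p hp => ?_).trans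
      (Nat.prod_primeFactors_dvd m)
    have hp' := Nat.prime_of_mem_primeFactors hp
    have hpN := Nat.dvd_of_mem_primeFactors hp
    have hQ1 : Q ≡ 1 [MOD p] := ((Nat.modEq_iff_dvd' (by lia)).2 (hdvd p hp' hpN)).symm
    have hNmod : ∑ i ∈ range m, Q ^ i ≡ m [MOD p] := by
      have hsum : ((∑ i ∈ range m, Q ^ i : ℕ) : ZMod p) = m := by
        have hcast : (Q : ZMod p) = 1 := by
          exact_mod_cast (ZMod.natCast_eq_natCast_iff Q 1 p).2 hQ1
        simp [hcast]
      exact (ZMod.natCast_eq_natCast_iff _ _ _).1 hsum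
    exact Nat.mem_primeFactors.2 ⟨hp', (hNmod.dvd_iff dvd_rfl).1 hpN, hm⟩
  by_contra hm1
  obtain ⟨l, rfl⟩ : ∃ l, m = l + 2 := ⟨m - 2, by lia⟩
  have hle := Nat.le_of_dvd (by lia) hNm
  have hlow : l ≤ ∑ i ∈ range l, Q ^ (i + 1 + 1) := by
    simpa using card_nsmul_le_sum (range l) (fun i => Q ^ (i + 1 + 1)) 1
      fun i _ => Nat.one_le_pow _ _ (by lia)
  rw [sum_range_succ', sum_range_succ'] at hle
  simp only [zero_add, pow_one, pow_zero] at hle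
  lia

/-- The subalgebra of elements that multiply a submodule of an algebra into itself. -/
def Submodule.mulStabilizer {F L : Type*} [CommSemiring F] [CommSemiring L] [Algebra F L]
    (V : Submodule F L) : Subalgebra F L where
  carrier := {y | ∀ v ∈ V, y * v ∈ V}
  mul_mem' {a b} ha hb v hv := by
    rw [mul_assoc]
    exact ha _ (hb v hv)
  add_mem' {a b} ha hb v hv := by
    rw [add_mul]
    exact V.add_mem (ha v hv) (hb v hv)
  algebraMap_mem' r v hv := by
    rw [← Algebra.smul_def]
    exact V.smul_mem r hv

/-- To stabilize a span it suffices to map the generators into the span. -/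
lemma Submodule.mem_mulStabilizer_span {F L : Type*} [CommSemiring F] [CommSemiring L]
    [Algebra F L] {s : Set L} {y : L} (h : ∀ v ∈ s, y * v ∈ span F s) :
    y ∈ (span F s).mulStabilizer := by
  intro v hv
  induction hv using span_induction with
  | mem v hv => exact h v hv
  | zero => simp
  | add u v _ _ hu hv => rw [mul_add]; exact add_mem hu hv
  | smul c v _ hv => rw [mul_smul_comm]; exact smul_mem _ c hv

/-- Multiplying an element of order `n` by an element killed by `n / ℓ` for all prime divisors
`ℓ ≠ p` of `n` preserves the order, provided the product is not killed by `n / p`. -/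
lemma orderOf_mul_eq_of_pow_div {G : Type*} [CommGroup G] {n p : ℕ} (hn : 0 < n) {x z : G}
    (hx : orderOf x = n) (hz : z ^ n = 1)
    (h : ∀ l, l.Prime → l ∣ n → l ≠ p → z ^ (n / l) = 1)
    (hp : (x * z) ^ (n / p) ≠ 1) : orderOf (x * z) = n := by
  have hxn : x ^ n = 1 := hx ▸ pow_orderOf_eq_one x
  refine orderOf_eq_of_pow_and_pow_div_prime hn (by rw [mul_pow, hxn, hz, one_mul])
    fun l hl hln => ?_
  obtain rfl | hlp := eq_or_ne l p
  · exact hp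
  · rw [mul_pow, h l hl hln hlp, mul_one]
    exact pow_ne_one_of_lt_orderOf (Nat.div_pos (Nat.le_of_dvd hn hln) hl.pos).ne'
      ((Nat.div_lt_self hn hl.one_lt).trans_eq hx.symm)

/-- A prime power dividing `n` still divides `n / l` for every other prime divisor `l`. -/
lemma Nat.Prime.pow_dvd_div_of_ne {n p l j : ℕ} (hp : p.Prime) (hl : l.Prime) (hlp : l ≠ p)
    (hln : l ∣ n) (h : p ^ j ∣ n) : p ^ j ∣ n / l := by
  obtain ⟨c, rfl⟩ := hln
  rw [Nat.mul_div_cancel_left _ hl.pos]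
  exact (((Nat.coprime_primes hp hl).2 hlp.symm).pow_left j).dvd_of_dvd_mul_left h

section PrimitiveSpan

variable (F L : Type*) [Field F] [Field L] [Algebra F L]

/-- The span of the generators of the unit group. -/
def primitiveSpan : Submodule F L :=
  Submodule.span F {x | ∃ u : Lˣ, orderOf u = Nat.card Lˣ ∧ (u : L) = x}

variable {F L} [Finite L]

lemma mem_mulStabilizer_primitiveSpan_of_pow {p j : ℕ} (hp : p.Prime)
    (hdvd : p ^ (j + 1) ∣ Nat.card Lˣ) {z : Lˣ} (hz : orderOf z = p ^ j) :
    (z : L) ∈ (primitiveSpan F L).mulStabilizer := by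
  refine Submodule.mem_mulStabilizer_span ?_
  rintro _ ⟨u, hu, rfl⟩
  refine Submodule.subset_span ⟨u * z, ?_, by simp [mul_comm]⟩
  have hj : p ^ j ∣ Nat.card Lˣ := (pow_dvd_pow p j.le_succ).trans hdvd
  have hpn : p ∣ Nat.card Lˣ := (dvd_pow_self p j.succ_ne_zero).trans hdvd
  have hn : 0 < Nat.card Lˣ := Nat.card_pos
  have hzp : z ^ (Nat.card Lˣ / p) = 1 := by
    rw [← orderOf_dvd_iff_pow_eq_one, hz]
    exact Nat.dvd_div_of_mul_dvd (by rwa [← pow_succ'])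
  refine orderOf_mul_eq_of_pow_div (p := p) hn hu pow_card_eq_one' (fun l hl hln hlp => ?_) ?_
  · rw [← orderOf_dvd_iff_pow_eq_one, hz]
    exact hp.pow_dvd_div_of_ne hl hlp hln hj
  · rw [mul_pow, hzp, mul_one]
    exact pow_ne_one_of_lt_orderOf (Nat.div_pos (Nat.le_of_dvd hn hpn) hp.pos).ne'
      ((Nat.div_lt_self hn hp.one_lt).trans_eq hu.symm)

lemma mem_mulStabilizer_primitiveSpan_of_not_sq_dvd {p : ℕ} (hp : p.Prime)
    (hdvd : p ∣ Nat.card Lˣ) (hsq : ¬ p ^ 2 ∣ Nat.card Lˣ) {z : Lˣ} (hz : orderOf z = p) :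
    (z : L) ∈ (primitiveSpan F L).mulStabilizer := by
  refine Submodule.mem_mulStabilizer_span ?_
  rintro _ ⟨u, hu, rfl⟩
  change _ ∈ primitiveSpan F L
  have hn : 0 < Nat.card Lˣ := Nat.card_pos
  have hcop : ¬ p ∣ Nat.card Lˣ / p := fun h =>
    hsq (by rw [sq]; exact Nat.mul_dvd_of_dvd_div hdvd h)
  have hmem (i : ℕ) (hi : (u * z ^ i) ^ (Nat.card Lˣ / p) ≠ 1) :
      (u * z ^ i : L) ∈ primitiveSpan F L := by
    refine Submodule.subset_span ⟨u * z ^ i, ?_, by simp⟩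
    refine orderOf_mul_eq_of_pow_div hn hu pow_card_eq_one' (fun l hl hln hlp => ?_) hi
    rw [← orderOf_dvd_iff_pow_eq_one]
    refine (orderOf_pow_dvd i).trans ?_
    simpa [hz] using hp.pow_dvd_div_of_ne (j := 1) hl hlp hln (by simpa using hdvd)
  rw [mul_comm]
  by_cases h1 : (u * z ^ 1) ^ (Nat.card Lˣ / p) = 1
  swap
  · simpa using hmem 1 h1
  have hsum : ∑ i ∈ Finset.range p, (u * z ^ i : L) = 0 := by
    have hroot : IsPrimitiveRoot (z : L) p :=
      IsPrimitiveRoot.coe_units_iff.2 (hz ▸ IsPrimitiveRoot.orderOf z)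
    rw [← Finset.mul_sum, hroot.geom_sum_eq_zero hp.one_lt, mul_zero]
  rw [← Finset.add_sum_erase _ _ (Finset.mem_range.2 hp.one_lt), pow_one] at hsum
  rw [eq_neg_of_add_eq_zero_left hsum]
  refine neg_mem (sum_mem fun i hi => hmem i fun hi1 => ?_)
  rw [Finset.mem_erase, Finset.mem_range] at hi
  have heq : z ^ (i * (Nat.card Lˣ / p)) = z ^ (1 * (Nat.card Lˣ / p)) := by
    rw [pow_mul, pow_mul]
    rw [mul_pow] at hi1 h1
    exact mul_left_cancel (hi1.trans h1.symm)
  rw [pow_eq_pow_iff_modEq, hz] at heq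
  have hmod := Nat.ModEq.cancel_right_of_coprime ((hp.coprime_iff_not_dvd).2 hcop) heq
  exact hi.1 (Nat.ModEq.eq_of_lt_of_lt hmod hi.2 hp.one_lt)

variable (F L) in
/-- The generators of the unit group of a finite field span it over any subfield. -/
theorem primitiveSpan_eq_top : primitiveSpan F L = ⊤ := by
  have : Fintype L := Fintype.ofFinite L
  let S : IntermediateField F L := (primitiveSpan F L).mulStabilizer.toIntermediateField
    fun x hx => by
      by_cases h0 : x = 0
      · simp [h0]
      rw [← eq_inv_of_mul_eq_one_left (a := x ^ (Nat.card Lˣ - 1))]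
      · exact pow_mem hx _
      · rw [← pow_succ, Nat.sub_add_cancel Nat.card_pos]
        exact congrArg Units.val (pow_card_eq_one' (x := Units.mk0 x h0))
  have : Fintype S := Fintype.ofFinite S
  obtain ⟨g, hg⟩ := IsCyclic.exists_ofOrder_eq_natCard (α := Lˣ)
  have hcard := Module.card_eq_pow_finrank (K := S) (V := L)
  have hunits : Nat.card Lˣ = Fintype.card L - 1 := by
    rw [Nat.card_units, Nat.card_eq_fintype_card]
  set Q := Fintype.card S
  set m := Module.finrank S L
  have hQ : 2 ≤ Q := Fintype.one_lt_card
  have hm : m ≠ 0 := Module.finrank_pos.ne'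
  have hprod : (∑ i ∈ Finset.range m, Q ^ i) * (Q - 1) = Nat.card Lˣ := by
    rw [hunits, hcard, Nat.geomSum_eq hQ, Nat.div_mul_cancel (Nat.sub_one_dvd_pow_sub_one Q m)]
  have hexists {d : ℕ} (hd : d ∣ Nat.card Lˣ) : ∃ z : Lˣ, orderOf z = d := by
    refine ⟨g ^ (Nat.card Lˣ / d), ?_⟩
    rw [← hg] at hd ⊢
    exact orderOf_pow_orderOf_div (orderOf_pos g).ne' hd
  have horder {z : Lˣ} (hz : (z : L) ∈ (primitiveSpan F L).mulStabilizer) :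
      orderOf z ∣ Q - 1 := by
    rw [orderOf_dvd_iff_pow_eq_one, Units.ext_iff]
    have := FiniteField.pow_card_sub_one_eq_one (⟨z, hz⟩ : S)
      fun h => z.ne_zero (congrArg Subtype.val h)
    simpa using congrArg Subtype.val this
  have hpow {p j : ℕ} (hp : p.Prime) (h : p ^ (j + 1) ∣ Nat.card Lˣ) : p ^ j ∣ Q - 1 := by
    obtain ⟨z, hz⟩ := hexists ((pow_dvd_pow p j.le_succ).trans h)
    exact hz ▸ horder (mem_mulStabilizer_primitiveSpan_of_pow hp h hz)
  have hm1 : m = 1 := by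
    refine eq_one_of_squarefree_geom_sum hQ hm ?_ fun p hp hpN => ?_
    · rw [Nat.squarefree_iff_prime_squarefree]
      intro p hp hpN
      have hall (j : ℕ) : p ^ j ∣ Q - 1 := by
        induction j with
        | zero => simp
        | succ j ih =>
          refine hpow hp ?_
          rw [← hprod, pow_succ', pow_succ', ← mul_assoc]
          exact mul_dvd_mul hpN ih
      exact (Nat.lt_pow_self hp.one_lt).not_ge (Nat.le_of_dvd (Nat.sub_pos_of_lt hQ) (hall (Q - 1)))
    · have hpn : p ∣ Nat.card Lˣ := hprod ▸ hpN.mul_right _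
      by_cases hsq : p ^ 2 ∣ Nat.card Lˣ
      · simpa using hpow (j := 1) hp hsq
      · obtain ⟨z, hz⟩ := hexists hpn
        exact hz ▸ horder (mem_mulStabilizer_primitiveSpan_of_not_sq_dvd hp hpn hsq hz)
  have hS : S = ⊤ := IntermediateField.finrank_eq_one_iff_eq_top.1 hm1
  refine eq_top_iff.2 fun x _ => ?_
  have hx : x * (g : L)⁻¹ ∈ S := hS ▸ IntermediateField.mem_top
  simpa using hx g (Submodule.subset_span ⟨g, hg, rfl⟩)

end PrimitiveSpan

theorem stmt11 (q k : ℕ) (hq1 : 1 < q) (hq : IsPrimePow q) (hk : 2 ≤ k)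
    (F : Type) [Field F] [Fintype F] (hF : Fintype.card F = q)
    (L : Type) [Field L] [Fintype L] [Algebra F L] (hL : Fintype.card L = q ^ k)
    (b : L) (hb : Algebra.trace F L b = 1) :
    ∃ lam : Lˣ, Subgroup.zpowers lam = ⊤ ∧ Algebra.trace F L ((lam : L) * b) ≠ 0 := by
  by_contra! h
  have hle : primitiveSpan F L ≤
      LinearMap.ker (Algebra.trace F L ∘ₗ LinearMap.mulRight F b) := by
    refine Submodule.span_le.2 ?_
    rintro _ ⟨u, hu, rfl⟩
    exact h u (Subgroup.eq_top_of_card_eq _ (by rw [Nat.card_zpowers, hu]))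
  rw [primitiveSpan_eq_top] at hle
  have h1 : Algebra.trace F L (1 * b) = 0 := hle (Submodule.mem_top (x := 1))
  rw [one_mul, hb] at h1
  exact one_ne_zero h1
end

section
/- Let p > 2 and k > 3 be distinct primes and let q = p^r > 3 for some r ≥ 1. Let M_a, M_b ∈ GL_k(F_q) be symmetric matrices and let S ∈ GL_k(F_q) be a symmetric matrix of order q^k − 1. Suppose that M_a M_b + M_b M_a = c·I_k for some nonzero scalar c ∈ F_q^×, and that M_a M_b S M_b M_a is not a power of S (i.e. does not lie in the cyclic subgroup ⟨S⟩). Set M_c := (M_a M_b + M_b M_a)^{−1} S. Then the subgroup of SL_{4k}(F_q) generated by {V_a(λ), V_b(λ), V_c(λ) : λ ∈ F_q} equals Sp_{4k}(F_q, Ω_{2k}), where Ω_{2k} is the 4k×4k block matrix ((0, −I_{2k}), (I_{2k}, 0)). -/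
open Matrix

/-- Assemble a `4 × 4` array of `k × k` blocks into a `4k × 4k` matrix. -/
def blocks4 {k : ℕ} {F : Type*} (B : Matrix (Fin 4) (Fin 4) (Matrix (Fin k) (Fin k) F)) :
    Matrix (Fin 4 × Fin k) (Fin 4 × Fin k) F :=
  Matrix.of fun p q => B p.1 q.1 p.2 q.2

/-- The matrix `V_a(λ)`. -/
def Va {k : ℕ} {F : Type*} [Field F] (Ma : Matrix (Fin k) (Fin k) F) (l : F) :
    Matrix (Fin 4 × Fin k) (Fin 4 × Fin k) F :=
  blocks4 !![1, 0, 0, l • Ma; 0, 1, l • Ma, 0; 0, 0, 1, 0; 0, 0, 0, 1]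

/-- The matrix `V_b(λ)`. -/
def Vb {k : ℕ} {F : Type*} [Field F] (Mb : Matrix (Fin k) (Fin k) F) (l : F) :
    Matrix (Fin 4 × Fin k) (Fin 4 × Fin k) F :=
  blocks4 !![1, 0, 0, 0; l • Mb, 1, 0, 0; 0, 0, 1, -(l • Mb); 0, 0, 0, 1]

/-- The matrix `V_c(λ)`. -/
def Vc {k : ℕ} {F : Type*} [Field F] (Mc : Matrix (Fin k) (Fin k) F) (l : F) :
    Matrix (Fin 4 × Fin k) (Fin 4 × Fin k) F :=
  blocks4 !![1, 0, 0, 0; 0, 1, 0, 0; 0, 0, 1, 0; 0, l • Mc, 0, 1]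

/-- The set `{V_a(λ), V_b(λ), V_c(λ) : λ ∈ F}`, viewed inside `SL_{4k}(F)`. -/
def genSet {k : ℕ} {F : Type*} [Field F] (Ma Mb Mc : Matrix (Fin k) (Fin k) F) :
    Set (Matrix.SpecialLinearGroup (Fin 4 × Fin k) F) :=
  {g | ∃ l : F,
      (g : Matrix (Fin 4 × Fin k) (Fin 4 × Fin k) F) = Va Ma l ∨
      (g : Matrix (Fin 4 × Fin k) (Fin 4 × Fin k) F) = Vb Mb l ∨
      (g : Matrix (Fin 4 × Fin k) (Fin 4 × Fin k) F) = Vc Mc l}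

/-- The standard symplectic matrix `Ω_{2k}` of size `4k`, with `2k × 2k` blocks
`((0, -I_{2k}), (I_{2k}, 0))`, written as a `4 × 4` array of `k × k` blocks. -/
def Omega2k {k : ℕ} {F : Type*} [Field F] : Matrix (Fin 4 × Fin k) (Fin 4 × Fin k) F :=
  blocks4 !![0, 0, -1, 0; 0, 0, 0, -1; 1, 0, 0, 0; 0, 1, 0, 0]


section Singer

variable {k : ℕ} {F : Type*} [Field F] [Fintype F] {S : Matrix (Fin k) (Fin k) F}

lemma card_adjoin_of_orderOf (hk : 1 < k) (hS : IsUnit S)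
    (hord : orderOf S = Fintype.card F ^ k - 1) :
    Nat.card (Algebra.adjoin F {S}) = Fintype.card F ^ k ∧
      ∀ x ∈ Algebra.adjoin F {S}, x = 0 ∨ ∃ i : ℕ, x = S ^ i := by
  classical
  have : Nonempty (Fin k) := ⟨⟨0, by omega⟩⟩
  have hq : 1 < Fintype.card F ^ k := Nat.one_lt_pow (by omega) Fintype.one_lt_card
  set T : Finset (Matrix (Fin k) (Fin k) F) :=
    Finset.univ.image (fun c : Fin k → F => ∑ i, c i • S ^ (i : ℕ)) with hT
  set U : Finset (Matrix (Fin k) (Fin k) F) :=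
    insert 0 ((Finset.range (Fintype.card F ^ k - 1)).image (S ^ ·)) with hU
  have hTcard : T.card ≤ Fintype.card F ^ k := by
    refine Finset.card_image_le.trans ?_
    simp
  have hUcard : U.card = Fintype.card F ^ k := by
    rw [hU, Finset.card_insert_of_notMem, Finset.card_image_of_injOn, Finset.card_range]
    · omega
    · rw [← hord]
      intro i hi j hj h
      exact pow_injOn_Iio_orderOf (by simpa using hi) (by simpa using hj) h
    · simp only [Finset.mem_image, not_exists, not_and]
      intro i _ h
      exact (hS.pow i).ne_zero h
  have hadj : ∀ x ∈ Algebra.adjoin F {S}, x ∈ T := by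
    intro x hx
    rw [Algebra.adjoin_singleton_eq_range_aeval] at hx
    obtain ⟨f, rfl⟩ := hx
    have hdeg : (f %ₘ S.charpoly).natDegree < k := by
      have := Polynomial.natDegree_modByMonic_lt f S.charpoly_monic (by
        intro h
        have := congrArg Polynomial.natDegree h
        rw [charpoly_natDegree_eq_dim, Fintype.card_fin, Polynomial.natDegree_one] at this
        omega)
      rwa [charpoly_natDegree_eq_dim, Fintype.card_fin] at this
    refine Finset.mem_image.2 ⟨fun i => (f %ₘ S.charpoly).coeff i, Finset.mem_univ _, ?_⟩
    change _ = Polynomial.aeval S f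
    rw [aeval_eq_aeval_mod_charpoly, Polynomial.aeval_eq_sum_range' hdeg,
      Finset.sum_range]
  have hpow : ∀ i, S ^ i ∈ Algebra.adjoin F {S} := fun i =>
    pow_mem (Algebra.self_mem_adjoin_singleton F S) i
  have hUadj : ∀ x ∈ U, x ∈ Algebra.adjoin F {S} := by
    intro x hx
    simp only [hU, Finset.mem_insert, Finset.mem_image] at hx
    rcases hx with rfl | ⟨i, -, rfl⟩
    · exact zero_mem _
    · exact hpow i
  have hUT : U = T := Finset.eq_of_subset_of_card_le (fun x hx => hadj x (hUadj x hx))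
    (hUcard ▸ hTcard)
  have hiff : ∀ x, x ∈ U ↔ x ∈ Algebra.adjoin F {S} := fun x =>
    ⟨hUadj x, fun h => hUT ▸ hadj x h⟩
  constructor
  · rw [← hUcard, ← Nat.card_eq_finsetCard U]
    exact Nat.card_congr (Equiv.subtypeEquivRight fun x => (hiff x).symm)
  · intro x hx
    have := (hiff x).2 hx
    simp only [hU, Finset.mem_insert, Finset.mem_image] at this
    rcases this with h | ⟨i, -, h⟩
    · exact Or.inl h
    · exact Or.inr ⟨i, h.symm⟩

lemma exists_mem_adjoin_mulVec_eq (hk : 1 < k) (hS : IsUnit S)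
    (hord : orderOf S = Fintype.card F ^ k - 1) {v : Fin k → F} (hv : v ≠ 0) (w : Fin k → F) :
    ∃ x ∈ Algebra.adjoin F {S}, x *ᵥ v = w := by
  obtain ⟨hcard, hK⟩ := card_adjoin_of_orderOf hk hS hord
  let f : Algebra.adjoin F {S} → (Fin k → F) := fun x => x.1 *ᵥ v
  have hf : Function.Injective f := by
    intro x y hxy
    have h : (x.1 - y.1) *ᵥ v = 0 := by
      rw [sub_mulVec]; exact sub_eq_zero.2 hxy
    rcases hK _ (sub_mem x.2 y.2) with h0 | ⟨i, hi⟩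
    · exact Subtype.ext (sub_eq_zero.1 h0)
    · rw [hi] at h
      exact absurd (mulVec_injective_iff_isUnit.2 (hS.pow i) (h.trans (mulVec_zero _).symm)) hv
  have hbij := (Nat.bijective_iff_injective_and_card f).2 ⟨hf, by rw [hcard]; simp⟩
  obtain ⟨x, hx⟩ := hbij.2 w
  exact ⟨x.1, x.2, hx⟩

lemma mem_adjoin_of_commute (hk : 1 < k) (hS : IsUnit S)
    (hord : orderOf S = Fintype.card F ^ k - 1) {t : Matrix (Fin k) (Fin k) F}
    (ht : Commute t S) : t ∈ Algebra.adjoin F {S} := by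
  have : Nonempty (Fin k) := ⟨⟨0, by omega⟩⟩
  have hcomm : ∀ x ∈ Algebra.adjoin F {S}, t * x = x * t := fun x hx =>
    (Algebra.commute_of_mem_adjoin_singleton_of_commute hx ht).eq
  obtain ⟨v, hv⟩ : ∃ v : Fin k → F, v ≠ 0 := exists_ne 0
  obtain ⟨x, hx, hxv⟩ := exists_mem_adjoin_mulVec_eq hk hS hord hv (t *ᵥ v)
  convert hx
  refine ext_of_mulVec_single fun i => ?_
  obtain ⟨y, hy, hyv⟩ := exists_mem_adjoin_mulVec_eq hk hS hord hv (Pi.single i 1)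
  have hxy : x * y = y * x := (Algebra.commute_of_mem_adjoin_singleton_of_commute hy
    (Algebra.commute_of_mem_adjoin_self hx).symm).eq
  rw [← hyv, mulVec_mulVec, mulVec_mulVec, hcomm y hy, hxy, ← mulVec_mulVec, ← mulVec_mulVec, hxv]

lemma commute_of_commute_commutator (hord : orderOf S = Fintype.card F ^ k - 1)
    {t : Matrix (Fin k) (Fin k) F} (hk : k ≠ 0)
    (h : Commute (t * S - S * t) S) : Commute t S := by
  set e := t * S - S * t with he
  have hpow : ∀ m : ℕ, t * S ^ (m + 1) = S ^ (m + 1) * t + ((m + 1 : ℕ) : F) • (S ^ m * e) := by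
    intro m
    induction m with
    | zero => simp [he]
    | succ m ih =>
      have h1 : t * S = S * t + e := by rw [he]; abel
      rw [pow_succ S (m + 1), ← mul_assoc, ih, add_mul, mul_assoc (S ^ (m + 1)) t S, h1, mul_add,
        smul_mul_assoc, mul_assoc (S ^ m) e S, h.eq, ← mul_assoc (S ^ m) S e, ← pow_succ,
        ← mul_assoc, Nat.cast_succ (m + 1), add_smul, one_smul]
      abel
  have hq : 1 ≤ Fintype.card F ^ k := Nat.one_le_pow _ _ Fintype.card_pos
  have hSq : S ^ (Fintype.card F ^ k) = S := by
    conv_lhs => rw [← Nat.sub_add_cancel hq, pow_succ, ← hord, pow_orderOf_eq_one, one_mul]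
  have := hpow (Fintype.card F ^ k - 1)
  rw [Nat.sub_add_cancel hq, hSq, Nat.cast_pow, FiniteField.cast_card_eq_zero, zero_pow hk,
    zero_smul, add_zero] at this
  exact this

/-- A matrix algebra over a finite field containing a Singer element of prime degree, and some
element not commuting with it, is the full matrix algebra. -/
theorem eq_top_of_singer_mem (hk : k.Prime) (hS : IsUnit S)
    (hord : orderOf S = Fintype.card F ^ k - 1) {A : Subalgebra F (Matrix (Fin k) (Fin k) F)}
    (hSA : S ∈ A) {d : Matrix (Fin k) (Fin k) F} (hd : d ∈ A) (hdS : ¬ Commute d S) : A = ⊤ := by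
  have hk1 := hk.one_lt
  have : Nonempty (Fin k) := ⟨⟨0, by omega⟩⟩
  obtain ⟨hcard, hK⟩ := card_adjoin_of_orderOf hk1 hS hord
  have hKA : Algebra.adjoin F {S} ≤ A := by
    rwa [Algebra.adjoin_le_iff, Set.singleton_subset_iff]
  have : IsSimpleModule A (Fin k → F) := by
    rw [isSimpleModule_iff_toSpanSingleton_surjective]
    refine ⟨inferInstance, fun v hv w => ?_⟩
    obtain ⟨x, hx, hxv⟩ := exists_mem_adjoin_mulVec_eq hk1 hS hord hv w
    exact ⟨⟨x, hKA hx⟩, hxv⟩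
  have : NoZeroDivisors (Algebra.adjoin F {S}) := ⟨by
    rintro ⟨x, hx⟩ ⟨y, hy⟩ hxy
    rcases hK x hx with rfl | ⟨i, rfl⟩
    · exact Or.inl rfl
    · refine Or.inr (Subtype.ext ?_)
      exact (hS.pow i).mul_left_cancel ((congrArg Subtype.val hxy).trans (mul_zero _).symm)⟩
  have : IsDomain (Algebra.adjoin F {S}) := NoZeroDivisors.to_isDomain _
  have hfin : Module.finrank F (Algebra.adjoin F {S}) = k := by
    have := Module.natCard_eq_pow_finrank (K := F) (V := Algebra.adjoin F {S})
    rw [hcard, Nat.card_eq_fintype_card] at this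
    exact (Nat.pow_right_injective Fintype.one_lt_card this).symm
  have := Subalgebra.isSimpleOrder_of_finrank_prime F (Algebra.adjoin F {S}) (hfin.symm ▸ hk)
  have hscalar : ∀ D : Matrix (Fin k) (Fin k) F, (∀ x ∈ A, D * x = x * D) →
      ∃ c : F, D = c • 1 := by
    intro D hD
    have hDK := mem_adjoin_of_commute hk1 hS hord (hD S hSA)
    have hbot : (Subalgebra.centralizer F {d}).comap (Algebra.adjoin F {S}).val = ⊥ := by
      refine (eq_bot_or_eq_top _).resolve_right fun htop => hdS ?_
      have : (⟨S, Algebra.self_mem_adjoin_singleton F S⟩ : Algebra.adjoin F {S}) ∈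
          (Subalgebra.centralizer F {d}).comap (Algebra.adjoin F {S}).val := by
        rw [htop]; trivial
      exact (Subalgebra.mem_centralizer_iff F).1 this d rfl
    have hmem : (⟨D, hDK⟩ : Algebra.adjoin F {S}) ∈
        (Subalgebra.centralizer F {d}).comap (Algebra.adjoin F {S}).val := by
      refine (Subalgebra.mem_centralizer_iff F).2 ?_
      rintro _ rfl
      exact (hD _ hd).symm
    rw [hbot, Algebra.mem_bot] at hmem
    obtain ⟨c, hc⟩ := hmem
    refine ⟨c, ?_⟩
    exact (congrArg Subtype.val hc).symm.trans (Algebra.algebraMap_eq_smul_one c)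
  classical
  rw [eq_top_iff]
  rintro M -
  let f : Module.End (Module.End A (Fin k → F)) (Fin k → F) :=
    { toFun := fun v => M *ᵥ v
      map_add' := fun v w => mulVec_add _ _ _
      map_smul' := by
        intro φ v
        let φF : (Fin k → F) →ₗ[F] (Fin k → F) :=
          { toFun := φ
            map_add' := map_add φ
            map_smul' := fun c v => by simp }
        obtain ⟨c, hc⟩ := hscalar (LinearMap.toMatrix' φF) (by
          intro x hx
          refine ext_of_mulVec_single fun i => ?_
          rw [← mulVec_mulVec, ← mulVec_mulVec, LinearMap.toMatrix'_mulVec,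
            LinearMap.toMatrix'_mulVec]
          exact φ.map_smul (⟨x, hx⟩ : A) _)
        have hφ : ∀ v, φ v = c • v := by
          intro v
          have := LinearMap.toMatrix'_mulVec φF v
          rw [hc, smul_mulVec, one_mulVec] at this
          exact this.symm
        change M *ᵥ (φ v) = φ (M *ᵥ v)
        rw [hφ, hφ, mulVec_smul] }
  obtain ⟨r, hr⟩ := jacobson_density f (Finset.univ.image fun i : Fin k => Pi.single i (1 : F))
  have : M = r := ext_of_mulVec_single fun i => hr _ (Finset.mem_image_of_mem _ (Finset.mem_univ i))
  rw [this]
  exact r.2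

end Singer

section SymplecticGeneration

variable {n F : Type*} [Fintype n] [DecidableEq n] [Field F]

lemma exists_isSymm_isUnit_add_mul {A C : Matrix n n F}
    (hker : ∀ x : n → F, A • x = 0 → C • x = 0 → x = 0) (hsymm : Aᵀ * C = Cᵀ * A) :
    ∃ X : Matrix n n F, X.IsSymm ∧ IsUnit (A + X * C) := by
  rcases exists_rank_normal_form C with ⟨V, U, s, hV, hU, heq⟩
  set P := V * C * U with P_def; set Q := Vᵀ⁻¹ * A * U with Q_def
  set f := fun (x : Matrix n n F) ↦ x.submatrix s.symm s.symm
  have hf (x) : f x = x.submatrix s.symm s.symm := rfl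
  have f_unit {x} : IsUnit x → IsUnit (f x) := (isUnit_submatrix_equiv ..).2
  have f_mul (x y) : f (x * y) = f x * f y := submatrix_mul _ _ _ _ _ s.symm.bijective
  have _ : Invertible V := hV.invertible
  have _ : Invertible U := hU.invertible
  have _ : Invertible (f Vᵀ) := (f_unit (V.isUnit_transpose.2 hV)).invertible
  have con1 (x : Fin C.rank ⊕ Fin (Fintype.card n - C.rank) → F)
      (heq1 : (f Q) • x = 0) (heq2 : (f P) • x = 0) : x = 0 := by
    refine (f_unit hU).smul_left_cancel.1 ?_
    rw [f_mul, f_mul, mul_assoc, mul_smul, IsUnit.smul_eq_zero, mul_smul, hf,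
      smul_eq_mulVec, submatrix_mulVec_equiv, Equiv.symm_symm] at heq1 heq2
    · rw [Equiv.comp_symm_eq, Pi.zero_comp] at heq1 heq2
      exact s.surjective.injective_comp_right <| by simpa using hker _ heq1 heq2
    · exact f_unit hV
    · exact f_unit <| isUnit_nonsing_inv_iff.2 <| V.isUnit_transpose.2 hV
  have con2 : Qᵀ * P = Pᵀ * Q := by
    simp only [P_def, mul_assoc, transpose_mul, transpose_nonsing_inv, transpose_transpose, Q_def,
      inv_mul_cancel_left_of_invertible, mul_inv_cancel_left_of_invertible]
    rw [← mul_assoc Aᵀ, hsymm, mul_assoc]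
  replace con2 : (f Q).toBlocks₁₁ᵀ = (f Q).toBlocks₁₁ ∧ (f Q).toBlocks₁₂ = 0 := by
    apply_fun reindex s s at con2
    rw [reindex_apply, reindex_apply, ← hf, ← hf, f_mul, f_mul Pᵀ, heq, hf,
      ← transpose_submatrix, ← hf Q, ← (f Q).fromBlocks_toBlocks, hf (_)ᵀ, hf
      ((fromBlocks 1 0 0 0).submatrix _ _)] at con2
    simp [fromBlocks_transpose, fromBlocks_multiply] at con2; tauto
  have con3 : IsUnit (f Q).toBlocks₂₂ := by
    refine mulVec_injective_iff_isUnit.1 ?_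
    rw [← coe_mulVecLin, ← LinearMap.ker_eq_bot]
    refine ker_mulVecLin_eq_bot_iff.2 fun x hx ↦ Sum.elim_injective' <|
      (con1 _ ?_ ?_).trans Sum.elim_zero_zero.symm
    · rw [← (f Q).fromBlocks_toBlocks]; simp [hx, con2.2, fromBlocks_mulVec]
    · simp [hf, heq, fromBlocks_mulVec]
  set Y : Matrix (Fin C.rank ⊕ Fin (Fintype.card n - C.rank)) (Fin C.rank ⊕
    Fin (Fintype.card n - C.rank)) F := fromBlocks (1 - (f Q).toBlocks₁₁) 0 0 0 with Y_def
  have hY_symm : Y.IsSymm := by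
    rw [Y_def, isSymm_fromBlocks_iff]
    exact ⟨IsSymm.sub isSymm_one con2.1, by simp⟩
  set X := (f Vᵀ) * Y * (f V) with X_def
  refine ⟨X.submatrix s s, IsSymm.submatrix ?_ s, (isUnit_submatrix_equiv s.symm s.symm).1 ?_⟩
  · simp_rw [X_def, Matrix.IsSymm, transpose_mul, hY_symm.eq, hf, transpose_submatrix,
      transpose_transpose, mul_assoc]
  · have heq' : f (A + X.submatrix s s * C) = (f Vᵀ) * (f Q + Y * (f P)) * f (U⁻¹) := by
      simp_rw [hf, submatrix_add, Pi.add_apply, Q_def, P_def, ← hf, f_mul, hf, mul_add, ← mul_assoc,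
        ← inv_submatrix_equiv, add_mul, mul_assoc _ (U.submatrix _ _), mul_inv_of_invertible]
      simp [X_def]; rfl
    rw [← hf, heq', IsUnit.mul_iff, IsUnit.mul_iff]
    refine ⟨⟨isUnit_of_invertible _, ?_⟩, ?_⟩
    · nth_rw 1 [Y_def, heq, ← (f Q).fromBlocks_toBlocks, con2.2]
      simpa [hf, fromBlocks_multiply, fromBlocks_add]
    · exact f_unit <| isUnit_nonsing_inv_iff.2 hU

variable {G : Submonoid (Matrix (n ⊕ n) (n ⊕ n) F)}

lemma fromBlocks_symm_inv_mem
    (hU : ∀ X : Matrix n n F, X.IsSymm → fromBlocks 1 X 0 1 ∈ G)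
    (hL : ∀ X : Matrix n n F, X.IsSymm → fromBlocks 1 0 X 1 ∈ G)
    {A : Matrix n n F} (hA : A.IsSymm) (hdet : IsUnit A.det) :
    fromBlocks A 0 0 Aᵀ⁻¹ ∈ G := by
  have weyl : ∀ B : Matrix n n F, B.IsSymm → IsUnit B.det → fromBlocks 0 B (-B⁻¹) 0 ∈ G := by
    intro B hB hBdet
    have hB' : (-B⁻¹).IsSymm := by
      rw [Matrix.IsSymm, transpose_neg, transpose_nonsing_inv, hB.eq]
    have := G.mul_mem (G.mul_mem (hU B hB) (hL _ hB')) (hU B hB)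
    simpa [fromBlocks_multiply, mul_nonsing_inv _ hBdet, nonsing_inv_mul _ hBdet] using this
  have h1 : (-1 : Matrix n n F)⁻¹ = -1 := inv_eq_right_inv (by simp)
  have := G.mul_mem (weyl A hA hdet) (weyl (-1) (isSymm_one.neg)
    ((isUnit_iff_isUnit_det _).1 isUnit_one.neg))
  simpa [fromBlocks_multiply, h1, hA.eq] using this

lemma fromBlocks_inv_transpose_mem
    (hU : ∀ X : Matrix n n F, X.IsSymm → fromBlocks 1 X 0 1 ∈ G)
    (hL : ∀ X : Matrix n n F, X.IsSymm → fromBlocks 1 0 X 1 ∈ G)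
    {A : Matrix n n F} (hdet : A.det ≠ 0) :
    fromBlocks A 0 0 Aᵀ⁻¹ ∈ G := by
  have hmul : ∀ A B : Matrix n n F, fromBlocks A 0 0 Aᵀ⁻¹ ∈ G → fromBlocks B 0 0 Bᵀ⁻¹ ∈ G →
      fromBlocks (A * B) 0 0 (A * B)ᵀ⁻¹ ∈ G := by
    intro A B hA hB
    simpa [fromBlocks_multiply, transpose_mul, Matrix.mul_inv_rev] using G.mul_mem hA hB
  refine diagonal_transvection_induction_of_det_ne_zero
    (fun A => fromBlocks A 0 0 Aᵀ⁻¹ ∈ G) A hdet ?_ ?_ (fun A B _ _ => hmul A B)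
  · intro D hD
    exact fromBlocks_symm_inv_mem hU hL (isSymm_diagonal D) hD.isUnit
  · rintro ⟨i, j, hij, c⟩
    set s : Matrix n n F :=
      1 - single i i 1 - single j j 1 + single i j 1 + single j i 1 with hs
    have hss : s * s = 1 := by
      simp only [hs, mul_add, add_mul, mul_sub, sub_mul, mul_one, one_mul,
        single_mul_single_same, single_mul_single_of_ne _ _ _ _ hij,
        single_mul_single_of_ne _ _ _ _ hij.symm]
      abel
    have hst : s * (s + single j j c) = transvection i j c := by
      rw [mul_add, hss, transvection]
      simp only [hs, add_mul, sub_mul, one_mul, single_mul_single_same,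
        single_mul_single_of_ne _ _ _ _ hij]
      abel
    have hsdet : IsUnit s.det := isUnit_det_of_left_inverse hss
    have hsymm : s.IsSymm := by
      simp only [hs, Matrix.IsSymm, transpose_add, transpose_sub, transpose_one, transpose_single]
      abel
    have htdet : IsUnit (s + single j j c).det := by
      have := congrArg det hst
      rw [det_mul, det_transvection_of_ne i j hij] at this
      exact IsUnit.of_mul_eq_one_right _ this
    have htsymm : (s + single j j c).IsSymm := by
      rw [Matrix.IsSymm, transpose_add, hsymm.eq, transpose_single]
    change fromBlocks (transvection i j c) 0 0 (transvection i j c)ᵀ⁻¹ ∈ G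
    rw [← hst]
    exact hmul _ _ (fromBlocks_symm_inv_mem hU hL hsymm hsdet)
      (fromBlocks_symm_inv_mem hU hL htsymm htdet)

/-- Over a field, the symplectic group is generated by its two opposite abelian unipotent
subgroups. -/
theorem symplecticGroup_le_of_unipotent_mem
    (hU : ∀ X : Matrix n n F, X.IsSymm → fromBlocks 1 X 0 1 ∈ G)
    (hL : ∀ X : Matrix n n F, X.IsSymm → fromBlocks 1 0 X 1 ∈ G) :
    symplecticGroup n F ≤ G := by
  have upper_symp : ∀ X : Matrix n n F, X.IsSymm → fromBlocks 1 X 0 1 ∈ symplecticGroup n F := by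
    intro X hX
    rw [SymplecticGroup.fromBlocks_mem_iff]
    simp [hX.eq]
  have lower_symp : ∀ X : Matrix n n F, X.IsSymm → fromBlocks 1 0 X 1 ∈ symplecticGroup n F := by
    intro X hX
    rw [SymplecticGroup.fromBlocks_mem_iff]
    simp [hX.eq]
  have key : ∀ A B C D : Matrix n n F, IsUnit A.det →
      fromBlocks A B C D ∈ symplecticGroup n F → fromBlocks A B C D ∈ G := by
    intro A B C D hA hM
    have hAC := (SymplecticGroup.fromBlocks_mem_iff.1 hM).1
    have hAT : IsUnit Aᵀ.det := by rwa [det_transpose]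
    have hY : (C * A⁻¹).IsSymm := by
      rw [Matrix.IsSymm, transpose_mul, transpose_nonsing_inv,
        ← mul_nonsing_inv_cancel_right A Cᵀ hA, ← hAC, mul_assoc,
        nonsing_inv_mul_cancel_left _ _ hAT]
    have h2 := (symplecticGroup n F).mul_mem (lower_symp _ hY.neg) hM
    have h3 : fromBlocks 1 0 (-(C * A⁻¹)) 1 * fromBlocks A B C D
        = fromBlocks A B 0 (-(C * A⁻¹) * B + D) := by
      simp [fromBlocks_multiply, mul_assoc, nonsing_inv_mul _ hA]
    rw [h3] at h2
    set D' := -(C * A⁻¹) * B + D with hD'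
    obtain ⟨-, hBD, hAD⟩ := SymplecticGroup.fromBlocks_mem_iff.1 h2
    rw [transpose_zero, zero_mul, sub_zero] at hAD
    have hD : D' = Aᵀ⁻¹ := (inv_eq_right_inv hAD).symm
    have hX : (A⁻¹ * B).IsSymm := by
      rw [Matrix.IsSymm, transpose_mul, transpose_nonsing_inv, ← hD, hBD, hD,
        transpose_nonsing_inv, transpose_transpose]
    have := G.mul_mem (G.mul_mem (hL _ hY) (fromBlocks_inv_transpose_mem hU hL hA.ne_zero))
      (hU _ hX)
    convert this using 1
    rw [← hD, hD']
    simp [fromBlocks_multiply, mul_assoc, nonsing_inv_mul _ hA, mul_nonsing_inv_cancel_left _ _ hA]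
  intro M hM
  have hM' := hM
  rw [← M.fromBlocks_toBlocks] at hM'
  obtain ⟨X, hX, hunit⟩ := exists_isSymm_isUnit_add_mul (A := M.toBlocks₁₁) (C := M.toBlocks₂₁)
    (fun x hx1 hx2 => by
      have hinj := mulVec_injective_iff_isUnit.2
        ((isUnit_iff_isUnit_det _).2 (SymplecticGroup.symplectic_det hM))
      have hv0 : M *ᵥ (Sum.elim x 0) = M *ᵥ (Sum.elim 0 0) := by
        rw [smul_eq_mulVec] at hx1 hx2
        rw [← M.fromBlocks_toBlocks]
        simp [fromBlocks_mulVec, hx1, hx2]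
      exact (Sum.elim_eq_iff.1 (hinj hv0)).1)
    (SymplecticGroup.fromBlocks_mem_iff.1 hM').1
  have h1 := key _ _ _ _ ((isUnit_iff_isUnit_det _).1 hunit) (by
    have := (symplecticGroup n F).mul_mem (upper_symp X hX) hM'
    rwa [fromBlocks_multiply, one_mul, one_mul, zero_mul, zero_mul, zero_add, zero_add,
      one_mul, one_mul] at this)
  have := G.mul_mem (hU _ hX.neg) h1
  convert this using 1
  conv_lhs => rw [← M.fromBlocks_toBlocks]
  simp [fromBlocks_multiply]

end SymplecticGeneration

section RootElements

variable {R : Type*} [Ring R]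

lemma mul_fin_four (a₁₁ a₁₂ a₁₃ a₁₄ a₂₁ a₂₂ a₂₃ a₂₄ a₃₁ a₃₂ a₃₃ a₃₄ a₄₁ a₄₂ a₄₃ a₄₄
    b₁₁ b₁₂ b₁₃ b₁₄ b₂₁ b₂₂ b₂₃ b₂₄ b₃₁ b₃₂ b₃₃ b₃₄ b₄₁ b₄₂ b₄₃ b₄₄ : R) :
    !![a₁₁, a₁₂, a₁₃, a₁₄; a₂₁, a₂₂, a₂₃, a₂₄; a₃₁, a₃₂, a₃₃, a₃₄; a₄₁, a₄₂, a₄₃, a₄₄] *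
    !![b₁₁, b₁₂, b₁₃, b₁₄; b₂₁, b₂₂, b₂₃, b₂₄; b₃₁, b₃₂, b₃₃, b₃₄; b₄₁, b₄₂, b₄₃, b₄₄] =
    !![a₁₁ * b₁₁ + a₁₂ * b₂₁ + a₁₃ * b₃₁ + a₁₄ * b₄₁, a₁₁ * b₁₂ + a₁₂ * b₂₂ + a₁₃ * b₃₂ + a₁₄ * b₄₂,
       a₁₁ * b₁₃ + a₁₂ * b₂₃ + a₁₃ * b₃₃ + a₁₄ * b₄₃, a₁₁ * b₁₄ + a₁₂ * b₂₄ + a₁₃ * b₃₄ + a₁₄ * b₄₄;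
       a₂₁ * b₁₁ + a₂₂ * b₂₁ + a₂₃ * b₃₁ + a₂₄ * b₄₁, a₂₁ * b₁₂ + a₂₂ * b₂₂ + a₂₃ * b₃₂ + a₂₄ * b₄₂,
       a₂₁ * b₁₃ + a₂₂ * b₂₃ + a₂₃ * b₃₃ + a₂₄ * b₄₃, a₂₁ * b₁₄ + a₂₂ * b₂₄ + a₂₃ * b₃₄ + a₂₄ * b₄₄;
       a₃₁ * b₁₁ + a₃₂ * b₂₁ + a₃₃ * b₃₁ + a₃₄ * b₄₁, a₃₁ * b₁₂ + a₃₂ * b₂₂ + a₃₃ * b₃₂ + a₃₄ * b₄₂,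
       a₃₁ * b₁₃ + a₃₂ * b₂₃ + a₃₃ * b₃₃ + a₃₄ * b₄₃, a₃₁ * b₁₄ + a₃₂ * b₂₄ + a₃₃ * b₃₄ + a₃₄ * b₄₄;
       a₄₁ * b₁₁ + a₄₂ * b₂₁ + a₄₃ * b₃₁ + a₄₄ * b₄₁, a₄₁ * b₁₂ + a₄₂ * b₂₂ + a₄₃ * b₃₂ + a₄₄ * b₄₂,
       a₄₁ * b₁₃ + a₄₂ * b₂₃ + a₄₃ * b₃₃ + a₄₄ * b₄₃, a₄₁ * b₁₄ + a₄₂ * b₂₄ + a₄₃ * b₃₄ + a₄₄ * b₄₄] := by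
  ext i j
  rw [mul_apply, Fin.sum_univ_four]
  fin_cases i <;> fin_cases j <;> rfl


/-- The root elements supported at the blocks `(1,2)` and `(4,3)`. -/
def rootX (x x' : R) : Matrix (Fin 4) (Fin 4) R :=
  !![1, x, 0, 0; 0, 1, 0, 0; 0, 0, 1, 0; 0, 0, -x', 1]

/-- The root elements supported at the blocks `(2,1)` and `(3,4)`. -/
def rootY (y y' : R) : Matrix (Fin 4) (Fin 4) R :=
  !![1, 0, 0, 0; y, 1, 0, 0; 0, 0, 1, -y'; 0, 0, 0, 1]

/-- The root elements supported at the blocks `(1,4)` and `(2,3)`. -/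
def rootZ (z z' : R) : Matrix (Fin 4) (Fin 4) R :=
  !![1, 0, 0, z; 0, 1, z', 0; 0, 0, 1, 0; 0, 0, 0, 1]

/-- The root elements supported at the blocks `(4,1)` and `(3,2)`. -/
def rootW (w w' : R) : Matrix (Fin 4) (Fin 4) R :=
  !![1, 0, 0, 0; 0, 1, 0, 0; 0, w', 1, 0; w, 0, 0, 1]

/-- The root elements supported at the block `(2,4)`. -/
def rootP (a : R) : Matrix (Fin 4) (Fin 4) R :=
  !![1, 0, 0, 0; 0, 1, 0, a; 0, 0, 1, 0; 0, 0, 0, 1]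

/-- The root elements supported at the block `(4,2)`. -/
def rootQ (a : R) : Matrix (Fin 4) (Fin 4) R :=
  !![1, 0, 0, 0; 0, 1, 0, 0; 0, 0, 1, 0; 0, a, 0, 1]

/-- The root elements supported at the block `(1,3)`. -/
def rootP' (a : R) : Matrix (Fin 4) (Fin 4) R :=
  !![1, 0, a, 0; 0, 1, 0, 0; 0, 0, 1, 0; 0, 0, 0, 1]

/-- The root elements supported at the block `(3,1)`. -/
def rootQ' (a : R) : Matrix (Fin 4) (Fin 4) R :=
  !![1, 0, 0, 0; 0, 1, 0, 0; a, 0, 1, 0; 0, 0, 0, 1]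

lemma rootX_mul (x x' y y' : R) :
    rootX x x' * rootX y y' = rootX (x + y) (x' + y') := by
  simp only [rootX, mul_fin_four, mul_zero, zero_mul, mul_one, one_mul,
    add_zero, zero_add, add_comm, neg_add]

lemma rootY_mul (x x' y y' : R) :
    rootY x x' * rootY y y' = rootY (x + y) (x' + y') := by
  simp only [rootY, mul_fin_four, mul_zero, zero_mul, mul_one, one_mul,
    add_zero, zero_add, add_comm, neg_add]

lemma rootZ_mul (x x' y y' : R) :
    rootZ x x' * rootZ y y' = rootZ (x + y) (x' + y') := by
  simp only [rootZ, mul_fin_four, mul_zero, zero_mul, mul_one, one_mul,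
    add_zero, zero_add, add_comm]

lemma rootW_mul (x x' y y' : R) :
    rootW x x' * rootW y y' = rootW (x + y) (x' + y') := by
  simp only [rootW, mul_fin_four, mul_zero, zero_mul, mul_one, one_mul,
    add_zero, zero_add, add_comm]

lemma rootP_mul (x y : R) :
    rootP x * rootP y = rootP (x + y) := by
  simp only [rootP, mul_fin_four, mul_zero, zero_mul, mul_one, one_mul,
    add_zero, zero_add, add_comm]

lemma rootQ_mul (x y : R) :
    rootQ x * rootQ y = rootQ (x + y) := by
  simp only [rootQ, mul_fin_four, mul_zero, zero_mul, mul_one, one_mul,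
    add_zero, zero_add, add_comm]

lemma rootP'_mul (x y : R) :
    rootP' x * rootP' y = rootP' (x + y) := by
  simp only [rootP', mul_fin_four, mul_zero, zero_mul, mul_one, one_mul,
    add_zero, zero_add, add_comm]

lemma rootQ'_mul (x y : R) :
    rootQ' x * rootQ' y = rootQ' (x + y) := by
  simp only [rootQ', mul_fin_four, mul_zero, zero_mul, mul_one, one_mul,
    add_zero, zero_add, add_comm]

lemma rootZ_rootQ (z z' a : R) :
    rootZ z z' * rootQ a * rootZ (-z) (-z') * rootQ (-a) = rootX (z * a) (a * z') * rootP' (-(z * a * z')) := by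
  simp only [rootZ, rootQ, rootX, rootP', mul_fin_four, mul_zero, zero_mul, mul_one, one_mul,
    add_zero, zero_add]
  noncomm_ring

lemma rootX_rootP (x x' a : R) :
    rootX x x' * rootP a * rootX (-x) (-x') * rootP (-a) = rootZ (x * a) (a * x') * rootP' (x * a * x') := by
  simp only [rootX, rootP, rootZ, rootP', mul_fin_four, mul_zero, zero_mul, mul_one, one_mul,
    add_zero, zero_add]
  noncomm_ring

lemma rootY_rootQ (y y' a : R) :
    rootY y y' * rootQ a * rootY (-y) (-y') * rootQ (-a) = rootW (-(a * y)) (-(y' * a)) * rootQ' (y' * a * y) := by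
  simp only [rootY, rootQ, rootW, rootQ', mul_fin_four, mul_zero, zero_mul, mul_one, one_mul,
    add_zero, zero_add]
  noncomm_ring

lemma rootW_rootP (w w' a : R) :
    rootW w w' * rootP a * rootW (-w) (-w') * rootP (-a) = rootY (-(a * w)) (-(w' * a)) * rootQ' (-(w' * a * w)) := by
  simp only [rootW, rootP, rootY, rootQ', mul_fin_four, mul_zero, zero_mul, mul_one, one_mul,
    add_zero, zero_add]
  noncomm_ring

lemma rootY_rootZ (y y' z z' : R) :
    rootY y y' * rootZ z z' * rootY (-y) (-y') * rootZ (-z) (-z') = rootP (y * z + z' * y') := by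
  simp only [rootY, rootZ, rootP, mul_fin_four, mul_zero, zero_mul, mul_one, one_mul,
    add_zero, zero_add]
  noncomm_ring

lemma rootX_rootZ (x x' z z' : R) :
    rootX x x' * rootZ z z' * rootX (-x) (-x') * rootZ (-z) (-z') = rootP' (x * z' + z * x') := by
  simp only [rootX, rootZ, rootP', mul_fin_four, mul_zero, zero_mul, mul_one, one_mul,
    add_zero, zero_add]
  noncomm_ring

lemma rootW_rootX (w w' x x' : R) :
    rootW w w' * rootX x x' * rootW (-w) (-w') * rootX (-x) (-x') = rootQ (w * x + x' * w') := by
  simp only [rootW, rootX, rootQ, mul_fin_four, mul_zero, zero_mul, mul_one, one_mul,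
    add_zero, zero_add]
  noncomm_ring

lemma rootW_rootY (w w' y y' : R) :
    rootW w w' * rootY y y' * rootW (-w) (-w') * rootY (-y) (-y') = rootQ' (w' * y + y' * w) := by
  simp only [rootW, rootY, rootQ', mul_fin_four, mul_zero, zero_mul, mul_one, one_mul,
    add_zero, zero_add]
  noncomm_ring

lemma one_fin_four : (1 : Matrix (Fin 4) (Fin 4) R) =
    !![1, 0, 0, 0; 0, 1, 0, 0; 0, 0, 1, 0; 0, 0, 0, 1] := by
  ext i j
  fin_cases i <;> fin_cases j <;> rfl

end RootElements

section RootSpace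

variable {F V V₁ V₂ V₃ N : Type*} [Field F] [Monoid N]
  [AddCommGroup V] [Module F V] [AddCommGroup V₁] [Module F V₁]
  [AddCommGroup V₂] [Module F V₂] [AddCommGroup V₃] [Module F V₃]

open Multiplicative

/-- The largest subspace whose image under a one-parameter family of homomorphisms `u` lies
in `G`. -/
def rootSpace (F : Type*) [Field F] [Module F V] (G : Submonoid N) (u : Multiplicative V →* N) :
    Submodule F V where
  carrier := {v | ∀ l : F, u (ofAdd (l • v)) ∈ G}
  zero_mem' l := by simp
  add_mem' {v w} hv hw l := by
    rw [smul_add, ofAdd_add, map_mul]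
    exact G.mul_mem (hv l) (hw l)
  smul_mem' c v hv l := by
    rw [smul_smul]
    exact hv _

lemma apply_mem_of_mem_rootSpace {G : Submonoid N} {u : Multiplicative V →* N} {v : V}
    (hv : v ∈ rootSpace F G u) : u (ofAdd v) ∈ G := by
  simpa using hv 1

lemma apply_ofAdd_mul_neg (u : Multiplicative V →* N) (v : V) :
    u (ofAdd v) * u (ofAdd (-v)) = 1 := by
  rw [← map_mul, ← ofAdd_add, add_neg_cancel, ofAdd_zero, map_one]

lemma apply_ofAdd_neg_mul (u : Multiplicative V →* N) (v : V) :
    u (ofAdd (-v)) * u (ofAdd v) = 1 := by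
  rw [← map_mul, ← ofAdd_add, neg_add_cancel, ofAdd_zero, map_one]

lemma commutator_mem {G : Submonoid N} {e : Multiplicative V →* N} {f : Multiplicative V₁ →* N}
    {z : V} {a : V₁} (hz : z ∈ rootSpace F G e) (ha : a ∈ rootSpace F G f) :
    e (ofAdd z) * f (ofAdd a) * e (ofAdd (-z)) * f (ofAdd (-a)) ∈ G :=
  G.mul_mem (G.mul_mem (G.mul_mem (apply_mem_of_mem_rootSpace hz)
    (apply_mem_of_mem_rootSpace ha)) (apply_mem_of_mem_rootSpace (neg_mem hz)))
    (apply_mem_of_mem_rootSpace (neg_mem ha))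

lemma mem_rootSpace_of_commutator {G : Submonoid N} {e : Multiplicative V →* N}
    {f : Multiplicative V₁ →* N} {u : Multiplicative V₂ →* N} {z : V} {a : V₁} {b : V₂}
    (hz : z ∈ rootSpace F G e) (ha : a ∈ rootSpace F G f)
    (h : ∀ l : F, e (ofAdd (l • z)) * f (ofAdd a) * e (ofAdd (-(l • z))) * f (ofAdd (-a)) =
      u (ofAdd (l • b))) : b ∈ rootSpace F G u := fun l => by
  rw [← h]
  exact commutator_mem (Submodule.smul_mem _ l hz) ha

/-- If a commutator is a product of a part which is linear and a part which is quadratic in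
the first argument, then both parts are obtained separately. -/
lemma mem_rootSpace_of_commutator_quadratic (h2 : (2 : F) ≠ 0) {G : Submonoid N}
    {e : Multiplicative V →* N}
    {f : Multiplicative V₁ →* N} {u : Multiplicative V₂ →* N} {u' : Multiplicative V₃ →* N}
    {z : V} {a : V₁} {b : V₂} {d : V₃}
    (hz : z ∈ rootSpace F G e) (ha : a ∈ rootSpace F G f)
    (h : ∀ l m : F, e (ofAdd (l • z)) * f (ofAdd (m • a)) * e (ofAdd (-(l • z))) *
      f (ofAdd (-(m • a))) = u (ofAdd ((l * m) • b)) * u' (ofAdd ((l * l * m) • d))) :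
    b ∈ rootSpace F G u ∧ d ∈ rootSpace F G u' := by
  have hd : d ∈ rootSpace F G u' := fun l => by
    obtain ⟨m, rfl⟩ : ∃ m, l = m + m := ⟨l / 2, by field_simp; ring⟩
    have h₁ := h 1 m
    have h₂ := h (-1) (-m)
    simp only [one_smul, one_mul, mul_neg, neg_mul, neg_smul, neg_neg] at h₁ h₂
    have h₃ : e (ofAdd (-z)) * f (ofAdd (-(m • a))) * e (ofAdd z) * f (ofAdd (m • a)) *
        u' (ofAdd ((m + m) • d)) =
        e (ofAdd z) * f (ofAdd (m • a)) * e (ofAdd (-z)) * f (ofAdd (-(m • a))) := by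
      rw [h₁, h₂, mul_assoc, ← map_mul, ← ofAdd_add, add_smul, neg_add_cancel_left]
    have h₄ : f (ofAdd (-(m • a))) * e (ofAdd (-z)) * f (ofAdd (m • a)) * e (ofAdd z) *
        (e (ofAdd (-z)) * f (ofAdd (-(m • a))) * e (ofAdd z) * f (ofAdd (m • a))) = 1 := by
      have h₅ : ∀ t, e (ofAdd z) * (e (ofAdd (-z)) * t) = t := fun t => by
        rw [← mul_assoc, apply_ofAdd_mul_neg, one_mul]
      have h₆ : ∀ t, f (ofAdd (m • a)) * (f (ofAdd (-(m • a))) * t) = t := fun t => by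
        rw [← mul_assoc, apply_ofAdd_mul_neg, one_mul]
      have h₇ : ∀ t, e (ofAdd (-z)) * (e (ofAdd z) * t) = t := fun t => by
        rw [← mul_assoc, apply_ofAdd_neg_mul, one_mul]
      simp only [mul_assoc, h₅, h₆, h₇, apply_ofAdd_neg_mul]
    rw [← one_mul (u' _), ← h₄, mul_assoc, h₃]
    have hma := Submodule.smul_mem _ m ha
    exact G.mul_mem (G.mul_mem (G.mul_mem (G.mul_mem
      (apply_mem_of_mem_rootSpace (neg_mem hma)) (apply_mem_of_mem_rootSpace (neg_mem hz)))
      (apply_mem_of_mem_rootSpace hma)) (apply_mem_of_mem_rootSpace hz))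
      (commutator_mem hz hma)
  refine ⟨fun l => ?_, hd⟩
  have h₁ := h 1 l
  simp only [one_smul, one_mul] at h₁
  have h₂ : u (ofAdd (l • b)) = u (ofAdd (l • b)) * u' (ofAdd (l • d)) * u' (ofAdd (-(l • d))) := by
    rw [mul_assoc, apply_ofAdd_mul_neg, mul_one]
  rw [h₂, ← h₁]
  exact G.mul_mem (commutator_mem hz (Submodule.smul_mem _ l ha))
    (apply_mem_of_mem_rootSpace (neg_mem (Submodule.smul_mem _ l hd)))

end RootSpace

section RootHom

variable {k : ℕ} {F : Type*} [Field F]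

open Multiplicative

/-- The one-parameter family `rootX` as a homomorphism. -/
def homX : Multiplicative (Matrix (Fin k) (Fin k) F) →*
    Matrix (Fin 4) (Fin 4) (Matrix (Fin k) (Fin k) F) where
  toFun v := rootX v.toAdd v.toAddᵀ
  map_one' := by simp [rootX, one_fin_four]
  map_mul' v w := by rw [rootX_mul, ← transpose_add, toAdd_mul]

/-- The one-parameter family `rootY` as a homomorphism. -/
def homY : Multiplicative (Matrix (Fin k) (Fin k) F) →*
    Matrix (Fin 4) (Fin 4) (Matrix (Fin k) (Fin k) F) where
  toFun v := rootY v.toAdd v.toAddᵀ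
  map_one' := by simp [rootY, one_fin_four]
  map_mul' v w := by rw [rootY_mul, ← transpose_add, toAdd_mul]

/-- The one-parameter family `rootZ` as a homomorphism. -/
def homZ : Multiplicative (Matrix (Fin k) (Fin k) F) →*
    Matrix (Fin 4) (Fin 4) (Matrix (Fin k) (Fin k) F) where
  toFun v := rootZ v.toAdd v.toAddᵀ
  map_one' := by simp [rootZ, one_fin_four]
  map_mul' v w := by rw [rootZ_mul, ← transpose_add, toAdd_mul]

/-- The one-parameter family `rootW` as a homomorphism. -/
def homW : Multiplicative (Matrix (Fin k) (Fin k) F) →*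
    Matrix (Fin 4) (Fin 4) (Matrix (Fin k) (Fin k) F) where
  toFun v := rootW v.toAdd v.toAddᵀ
  map_one' := by simp [rootW, one_fin_four]
  map_mul' v w := by rw [rootW_mul, ← transpose_add, toAdd_mul]

/-- The one-parameter family `rootP` as a homomorphism. -/
def homP : Multiplicative (Matrix (Fin k) (Fin k) F) →*
    Matrix (Fin 4) (Fin 4) (Matrix (Fin k) (Fin k) F) where
  toFun v := rootP v.toAdd
  map_one' := by simp [rootP, one_fin_four]
  map_mul' v w := by rw [rootP_mul, toAdd_mul]

/-- The one-parameter family `rootQ` as a homomorphism. -/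
def homQ : Multiplicative (Matrix (Fin k) (Fin k) F) →*
    Matrix (Fin 4) (Fin 4) (Matrix (Fin k) (Fin k) F) where
  toFun v := rootQ v.toAdd
  map_one' := by simp [rootQ, one_fin_four]
  map_mul' v w := by rw [rootQ_mul, toAdd_mul]

/-- The one-parameter family `rootP'` as a homomorphism. -/
def homP' : Multiplicative (Matrix (Fin k) (Fin k) F) →*
    Matrix (Fin 4) (Fin 4) (Matrix (Fin k) (Fin k) F) where
  toFun v := rootP' v.toAdd
  map_one' := by simp [rootP', one_fin_four]
  map_mul' v w := by rw [rootP'_mul, toAdd_mul]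

/-- The one-parameter family `rootQ'` as a homomorphism. -/
def homQ' : Multiplicative (Matrix (Fin k) (Fin k) F) →*
    Matrix (Fin 4) (Fin 4) (Matrix (Fin k) (Fin k) F) where
  toFun v := rootQ' v.toAdd
  map_one' := by simp [rootQ', one_fin_four]
  map_mul' v w := by rw [rootQ'_mul, toAdd_mul]

variable {G : Submonoid (Matrix (Fin 4) (Fin 4) (Matrix (Fin k) (Fin k) F))}
  {w x y z a : Matrix (Fin k) (Fin k) F}

lemma mul_mem_homX (h2 : (2 : F) ≠ 0) (hz : z ∈ rootSpace F G homZ) (ha : a ∈ rootSpace F G homQ)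
    (hs : a.IsSymm) : z * a ∈ rootSpace F G homX :=
  (mem_rootSpace_of_commutator_quadratic (u' := homP') (d := -(z * a * zᵀ)) h2 hz ha
    fun l m => by
      refine (rootZ_rootQ (l • z) (l • z)ᵀ (m • a)).trans ?_
      change _ = rootX ((l * m) • (z * a)) ((l * m) • (z * a))ᵀ * rootP' _
      simp [hs.eq, smul_smul, mul_comm, mul_left_comm]).1

lemma mul_mem_homZ (h2 : (2 : F) ≠ 0) (hx : x ∈ rootSpace F G homX) (ha : a ∈ rootSpace F G homP)
    (hs : a.IsSymm) : x * a ∈ rootSpace F G homZ :=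
  (mem_rootSpace_of_commutator_quadratic (u' := homP') (d := x * a * xᵀ) h2 hx ha
    fun l m => by
      refine (rootX_rootP (l • x) (l • x)ᵀ (m • a)).trans ?_
      change _ = rootZ ((l * m) • (x * a)) ((l * m) • (x * a))ᵀ * rootP' _
      simp [hs.eq, smul_smul, mul_comm, mul_left_comm]).1

lemma mul_mem_homW (h2 : (2 : F) ≠ 0) (hy : y ∈ rootSpace F G homY) (ha : a ∈ rootSpace F G homQ)
    (hs : a.IsSymm) : a * y ∈ rootSpace F G homW := by
  rw [← neg_neg (a * y)]
  exact neg_mem (mem_rootSpace_of_commutator_quadratic (u' := homQ') (d := yᵀ * a * y) h2 hy ha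
    fun l m => by
      refine (rootY_rootQ (l • y) (l • y)ᵀ (m • a)).trans ?_
      change _ = rootW ((l * m) • (-(a * y))) ((l * m) • (-(a * y)))ᵀ * rootQ' _
      simp [hs.eq, smul_smul, mul_comm, mul_left_comm]).1

lemma mul_mem_homY (h2 : (2 : F) ≠ 0) (hw : w ∈ rootSpace F G homW) (ha : a ∈ rootSpace F G homP)
    (hs : a.IsSymm) : a * w ∈ rootSpace F G homY := by
  rw [← neg_neg (a * w)]
  exact neg_mem (mem_rootSpace_of_commutator_quadratic (u' := homQ') (d := -(wᵀ * a * w)) h2 hw ha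
    fun l m => by
      refine (rootW_rootP (l • w) (l • w)ᵀ (m • a)).trans ?_
      change _ = rootY ((l * m) • (-(a * w))) ((l * m) • (-(a * w)))ᵀ * rootQ' _
      simp [hs.eq, smul_smul, mul_comm, mul_left_comm]).1

lemma mem_homP (hy : y ∈ rootSpace F G homY) (hz : z ∈ rootSpace F G homZ) :
    y * z + zᵀ * yᵀ ∈ rootSpace F G homP :=
  mem_rootSpace_of_commutator hy hz fun l => by
    refine (rootY_rootZ (l • y) (l • y)ᵀ z zᵀ).trans ?_
    change _ = rootP (l • (y * z + zᵀ * yᵀ))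
    simp

lemma mem_homP' (hx : x ∈ rootSpace F G homX) (hz : z ∈ rootSpace F G homZ) :
    x * zᵀ + z * xᵀ ∈ rootSpace F G homP' :=
  mem_rootSpace_of_commutator hx hz fun l => by
    refine (rootX_rootZ (l • x) (l • x)ᵀ z zᵀ).trans ?_
    change _ = rootP' (l • (x * zᵀ + z * xᵀ))
    simp

lemma mem_homQ (hw : w ∈ rootSpace F G homW) (hx : x ∈ rootSpace F G homX) :
    w * x + xᵀ * wᵀ ∈ rootSpace F G homQ :=
  mem_rootSpace_of_commutator hw hx fun l => by
    refine (rootW_rootX (l • w) (l • w)ᵀ x xᵀ).trans ?_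
    change _ = rootQ (l • (w * x + xᵀ * wᵀ))
    simp

lemma mem_homQ' (hw : w ∈ rootSpace F G homW) (hy : y ∈ rootSpace F G homY) :
    wᵀ * y + yᵀ * w ∈ rootSpace F G homQ' :=
  mem_rootSpace_of_commutator hw hy fun l => by
    refine (rootW_rootY (l • w) (l • w)ᵀ y yᵀ).trans ?_
    change _ = rootQ' (l • (wᵀ * y + yᵀ * w))
    simp

end RootHom

section Generation

variable {k : ℕ} {F : Type*} [Field F]
  {G : Submonoid (Matrix (Fin 4) (Fin 4) (Matrix (Fin k) (Fin k) F))}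
  {S : Matrix (Fin k) (Fin k) F}

lemma homX_eq_homZ (h2 : (2 : F) ≠ 0) (hS : S.IsSymm) (hfin : IsOfFinOrder S)
    (hSQ : S ∈ rootSpace F G homQ) (h1P : 1 ∈ rootSpace F G homP) :
    rootSpace F G homX = rootSpace F G homZ := by
  have hXZ : ∀ x ∈ rootSpace F G homX, x ∈ rootSpace F G homZ := fun x hx => by
    simpa using mul_mem_homZ h2 hx h1P isSymm_one
  refine le_antisymm hXZ fun z hz => ?_
  have hpow : ∀ n : ℕ, z * S ^ n ∈ rootSpace F G homZ := fun n => by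
    induction n with
    | zero => simpa using hz
    | succ n ih =>
      rw [pow_succ, ← mul_assoc]
      exact hXZ _ (mul_mem_homX h2 ih hSQ hS)
  have := mul_mem_homX h2 (hpow (orderOf S - 1)) hSQ hS
  rwa [mul_assoc, ← pow_succ, Nat.sub_add_cancel hfin.orderOf_pos, pow_orderOf_eq_one,
    mul_one] at this

lemma homW_eq_homY (h2 : (2 : F) ≠ 0) (hS : S.IsSymm) (hfin : IsOfFinOrder S)
    (hSQ : S ∈ rootSpace F G homQ) (h1P : 1 ∈ rootSpace F G homP) :
    rootSpace F G homW = rootSpace F G homY := by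
  have hWY : ∀ w ∈ rootSpace F G homW, w ∈ rootSpace F G homY := fun w hw => by
    simpa using mul_mem_homY h2 hw h1P isSymm_one
  refine le_antisymm hWY fun y hy => ?_
  have hpow : ∀ n : ℕ, S ^ n * y ∈ rootSpace F G homY := fun n => by
    induction n with
    | zero => simpa using hy
    | succ n ih =>
      rw [pow_succ', mul_assoc]
      exact hWY _ (mul_mem_homW h2 ih hSQ hS)
  have := mul_mem_homW h2 (hpow (orderOf S - 1)) hSQ hS
  rwa [← mul_assoc, ← pow_succ', Nat.sub_add_cancel hfin.orderOf_pos, pow_orderOf_eq_one,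
    one_mul] at this

lemma eq_top_of_isUnit_of_mul_right {s : Set (Matrix (Fin k) (Fin k) F)}
    (hs : Algebra.adjoin F s = ⊤) {Z : Submodule F (Matrix (Fin k) (Fin k) F)}
    {a : Matrix (Fin k) (Fin k) F} (ha : IsUnit a) (haZ : a ∈ Z)
    (h : ∀ z ∈ Z, ∀ m ∈ s, z * m ∈ Z) : Z = ⊤ := by
  have key : ∀ m ∈ Algebra.adjoin F s, ∀ z ∈ Z, z * m ∈ Z := fun m hm => by
    induction hm using Algebra.adjoin_induction with
    | mem m hm => exact fun z hz => h z hz m hm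
    | algebraMap r =>
      intro z hz
      rw [Algebra.algebraMap_eq_smul_one, mul_smul_comm, mul_one]
      exact Z.smul_mem r hz
    | add m n _ _ hm hn =>
      intro z hz
      rw [mul_add]
      exact Z.add_mem (hm z hz) (hn z hz)
    | mul m n _ _ hm hn =>
      intro z hz
      rw [← mul_assoc]
      exact hn _ (hm z hz)
  obtain ⟨u, rfl⟩ := ha
  refine eq_top_iff.2 fun m _ => ?_
  have := key ((↑u⁻¹ : Matrix (Fin k) (Fin k) F) * m) (by rw [hs]; trivial) _ haZ
  rwa [← mul_assoc, Units.mul_inv, one_mul] at this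

lemma eq_top_of_isUnit_of_mul_left {s : Set (Matrix (Fin k) (Fin k) F)}
    (hs : Algebra.adjoin F s = ⊤) {Y : Submodule F (Matrix (Fin k) (Fin k) F)}
    {b : Matrix (Fin k) (Fin k) F} (hb : IsUnit b) (hbY : b ∈ Y)
    (h : ∀ y ∈ Y, ∀ m ∈ s, m * y ∈ Y) : Y = ⊤ := by
  have key : ∀ m ∈ Algebra.adjoin F s, ∀ y ∈ Y, m * y ∈ Y := fun m hm => by
    induction hm using Algebra.adjoin_induction with
    | mem m hm => exact fun y hy => h y hy m hm
    | algebraMap r =>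
      intro y hy
      rw [Algebra.algebraMap_eq_smul_one, smul_mul_assoc, one_mul]
      exact Y.smul_mem r hy
    | add m n _ _ hm hn =>
      intro y hy
      rw [add_mul]
      exact Y.add_mem (hm y hy) (hn y hy)
    | mul m n _ _ hm hn =>
      intro y hy
      rw [mul_assoc]
      exact hm _ (hn y hy)
  obtain ⟨u, rfl⟩ := hb
  refine eq_top_iff.2 fun m _ => ?_
  have := key (m * (↑u⁻¹ : Matrix (Fin k) (Fin k) F)) (by rw [hs]; trivial) _ hbY
  rwa [mul_assoc, Units.inv_mul, mul_one] at this

lemma not_commute_of_not_pow [Fintype F] (hk : 1 < k) (hS : IsUnit S)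
    (hord : orderOf S = Fintype.card F ^ k - 1) {a b : Matrix (Fin k) (Fin k) F} {c : F}
    (ha : IsUnit a) (hb : IsUnit b)
    (hc : a * b + b * a = c • 1) (hpow : ¬ ∃ n : ℕ, a * b * S * b * a = S ^ n) :
    ¬ Commute (S * b * a + a * b * S) S := by
  intro hcomm
  have hba : b * a = c • 1 - a * b := by rw [← hc, add_sub_cancel_left]
  have heq : S * b * a + a * b * S = c • S + (a * b * S - S * (a * b)) := by
    rw [mul_assoc, hba, mul_sub, mul_smul_comm, mul_one]
    abel
  have hcomm' : Commute (a * b * S - S * (a * b)) S := by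
    have := hcomm.sub_left ((Commute.refl S).smul_left c)
    rwa [heq, add_sub_cancel_left] at this
  have ht := mem_adjoin_of_commute hk hS hord
    (commute_of_commute_commutator hord (by omega) hcomm')
  have hmem : a * b * S * b * a ∈ Algebra.adjoin F {S} := by
    rw [mul_assoc _ b a, hba]
    exact mul_mem (mul_mem ht (Algebra.self_mem_adjoin_singleton F S))
      (sub_mem (Subalgebra.smul_mem _ (one_mem _) c) ht)
  rcases (card_adjoin_of_orderOf hk hS hord).2 _ hmem with h0 | hn
  · have hu : IsUnit (a * b * S * b * a) := (((ha.mul hb).mul hS).mul hb).mul ha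
    have : Nonempty (Fin k) := ⟨⟨0, by omega⟩⟩
    exact hu.ne_zero h0
  · exact hpow hn

theorem rootSpace_eq_top [Fintype F] (h2 : (2 : F) ≠ 0) (hk : k.Prime) (hS : IsUnit S)
    (hSsymm : S.IsSymm) (hord : orderOf S = Fintype.card F ^ k - 1)
    {a b : Matrix (Fin k) (Fin k) F} {c : F} (hc0 : c ≠ 0)
    (hasymm : a.IsSymm) (hbsymm : b.IsSymm) (ha : IsUnit a) (hb : IsUnit b)
    (hc : a * b + b * a = c • 1) (hpow : ¬ ∃ n : ℕ, a * b * S * b * a = S ^ n)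
    (haZ : a ∈ rootSpace F G homZ) (hbY : b ∈ rootSpace F G homY)
    (hSQ : S ∈ rootSpace F G homQ) :
    rootSpace F G homX = ⊤ ∧ rootSpace F G homY = ⊤ ∧ rootSpace F G homZ = ⊤ ∧
      rootSpace F G homW = ⊤ := by
  have h1P : (1 : Matrix (Fin k) (Fin k) F) ∈ rootSpace F G homP := by
    have := mem_homP hbY haZ
    rwa [hasymm.eq, hbsymm.eq, add_comm, hc, Submodule.smul_mem_iff _ hc0] at this
  have hfin : IsOfFinOrder S := by
    rw [← orderOf_pos_iff, hord]
    exact Nat.sub_pos_of_lt (Nat.one_lt_pow hk.ne_zero Fintype.one_lt_card)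
  have hXZ := homX_eq_homZ h2 hSsymm hfin hSQ h1P
  have hWY := homW_eq_homY h2 hSsymm hfin hSQ h1P
  have hd : S * b * a + a * b * S ∈ rootSpace F G homP := by
    have := mem_homP (hWY ▸ mul_mem_homW h2 hbY hSQ hSsymm) haZ
    rwa [transpose_mul, hasymm.eq, hbsymm.eq, hSsymm.eq, ← mul_assoc a] at this
  have hdsymm : (S * b * a + a * b * S).IsSymm := by
    simp [IsSymm, hasymm.eq, hbsymm.eq, hSsymm.eq, mul_assoc, add_comm]
  have htop : Algebra.adjoin F {S, S * b * a + a * b * S} = ⊤ :=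
    eq_top_of_singer_mem hk hS hord (Algebra.subset_adjoin (by simp))
      (Algebra.subset_adjoin (by simp))
      (not_commute_of_not_pow hk.one_lt hS hord ha hb hc hpow)
  have hZ : rootSpace F G homZ = ⊤ := by
    refine eq_top_of_isUnit_of_mul_right htop ha haZ ?_
    rintro z hz m (rfl | rfl)
    · exact hXZ ▸ mul_mem_homX h2 hz hSQ hSsymm
    · exact mul_mem_homZ h2 (hXZ ▸ hz) hd hdsymm
  have hY : rootSpace F G homY = ⊤ := by
    refine eq_top_of_isUnit_of_mul_left htop hb hbY ?_
    rintro y hy m (rfl | rfl)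
    · exact hWY ▸ mul_mem_homW h2 hy hSQ hSsymm
    · exact mul_mem_homY h2 (hWY ▸ hy) hd hdsymm
  exact ⟨hXZ.trans hZ, hY, hZ, hWY.trans hY⟩

lemma half_add_half_transpose (h2 : (2 : F) ≠ 0) {m : Matrix (Fin k) (Fin k) F} (hm : m.IsSymm) :
    (2⁻¹ : F) • m + (2⁻¹ : F) • mᵀ = m := by
  rw [hm.eq, ← add_smul, ← two_mul, mul_inv_cancel₀ h2, one_smul]

lemma upper_mem (h2 : (2 : F) ≠ 0) (hX : rootSpace F G homX = ⊤) (hY : rootSpace F G homY = ⊤)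
    (hZ : rootSpace F G homZ = ⊤) {m n : Matrix (Fin k) (Fin k) F} (hm : m.IsSymm)
    (hn : n.IsSymm) (z : Matrix (Fin k) (Fin k) F) :
    !![1, 0, m, z; 0, 1, zᵀ, n; 0, 0, 1, 0; 0, 0, 0, 1] ∈ G := by
  have key : ∀ {U : Submodule F (Matrix (Fin k) (Fin k) F)}, U = ⊤ → ∀ x, x ∈ U :=
    fun h x => h ▸ Submodule.mem_top
  have hm' : m ∈ rootSpace F G homP' := by
    simpa [half_add_half_transpose h2 hm] using
      mem_homP' (key hX ((2⁻¹ : F) • m)) (key hZ 1)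
  have hn' : n ∈ rootSpace F G homP := by
    simpa [half_add_half_transpose h2 hn] using
      mem_homP (key hY ((2⁻¹ : F) • n)) (key hZ 1)
  have h : rootP' m * rootZ z zᵀ * rootP n ∈ G :=
    G.mul_mem (G.mul_mem (apply_mem_of_mem_rootSpace hm') (apply_mem_of_mem_rootSpace (key hZ z)))
      (apply_mem_of_mem_rootSpace hn')
  simpa only [rootP', rootZ, rootP, mul_fin_four, mul_zero, zero_mul, mul_one, one_mul,
    add_zero, zero_add] using h

lemma lower_mem (h2 : (2 : F) ≠ 0) (hX : rootSpace F G homX = ⊤) (hY : rootSpace F G homY = ⊤)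
    (hW : rootSpace F G homW = ⊤) {m n : Matrix (Fin k) (Fin k) F} (hm : m.IsSymm)
    (hn : n.IsSymm) (w : Matrix (Fin k) (Fin k) F) :
    !![1, 0, 0, 0; 0, 1, 0, 0; m, wᵀ, 1, 0; w, n, 0, 1] ∈ G := by
  have key : ∀ {U : Submodule F (Matrix (Fin k) (Fin k) F)}, U = ⊤ → ∀ x, x ∈ U :=
    fun h x => h ▸ Submodule.mem_top
  have hm' : m ∈ rootSpace F G homQ' := by
    simpa [half_add_half_transpose h2 hm] using
      mem_homQ' (key hW 1) (key hY ((2⁻¹ : F) • m))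
  have hn' : n ∈ rootSpace F G homQ := by
    simpa [half_add_half_transpose h2 hn] using
      mem_homQ (key hW 1) (key hX ((2⁻¹ : F) • n))
  have h : rootQ' m * rootW w wᵀ * rootQ n ∈ G :=
    G.mul_mem (G.mul_mem (apply_mem_of_mem_rootSpace hm') (apply_mem_of_mem_rootSpace (key hW w)))
      (apply_mem_of_mem_rootSpace hn')
  simpa only [rootQ', rootW, rootQ, mul_fin_four, mul_zero, zero_mul, mul_one, one_mul,
    add_zero, zero_add] using h

end Generation

section Blocks

variable {k : ℕ} {F : Type*}

/-- The regrouping of four blocks as two pairs of blocks. -/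
def blockEquiv (k : ℕ) : (Fin k ⊕ Fin k) ⊕ (Fin k ⊕ Fin k) ≃ Fin 4 × Fin k where
  toFun := Sum.elim (Sum.elim (Prod.mk 0) (Prod.mk 1)) (Sum.elim (Prod.mk 2) (Prod.mk 3))
  invFun x := ![.inl (.inl x.2), .inl (.inr x.2), .inr (.inl x.2), .inr (.inr x.2)] x.1
  left_inv := by rintro ((i | i) | (i | i)) <;> rfl
  right_inv := by
    rintro ⟨i, j⟩
    fin_cases i <;> rfl

lemma blocks4_submatrix (B : Matrix (Fin 4) (Fin 4) (Matrix (Fin k) (Fin k) F)) :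
    (blocks4 B).submatrix (blockEquiv k) (blockEquiv k) =
      fromBlocks (fromBlocks (B 0 0) (B 0 1) (B 1 0) (B 1 1))
        (fromBlocks (B 0 2) (B 0 3) (B 1 2) (B 1 3))
        (fromBlocks (B 2 0) (B 2 1) (B 3 0) (B 3 1))
        (fromBlocks (B 2 2) (B 2 3) (B 3 2) (B 3 3)) := by
  ext ((i | i) | (i | i)) ((j | j) | (j | j)) <;> rfl

lemma blocks4_transpose
    (a₁₁ a₁₂ a₁₃ a₁₄ a₂₁ a₂₂ a₂₃ a₂₄ a₃₁ a₃₂ a₃₃ a₃₄ a₄₁ a₄₂ a₄₃ a₄₄ :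
      Matrix (Fin k) (Fin k) F) :
    (blocks4 !![a₁₁, a₁₂, a₁₃, a₁₄; a₂₁, a₂₂, a₂₃, a₂₄; a₃₁, a₃₂, a₃₃, a₃₄;
      a₄₁, a₄₂, a₄₃, a₄₄])ᵀ =
    blocks4 !![a₁₁ᵀ, a₂₁ᵀ, a₃₁ᵀ, a₄₁ᵀ; a₁₂ᵀ, a₂₂ᵀ, a₃₂ᵀ, a₄₂ᵀ; a₁₃ᵀ, a₂₃ᵀ, a₃₃ᵀ, a₄₃ᵀ;
      a₁₄ᵀ, a₂₄ᵀ, a₃₄ᵀ, a₄₄ᵀ] := by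
  ext ⟨i, i'⟩ ⟨j, j'⟩
  fin_cases i <;> fin_cases j <;> rfl

variable [Field F]

lemma Omega2k_submatrix :
    (Omega2k (k := k) (F := F)).submatrix (blockEquiv k) (blockEquiv k) =
      J (Fin k ⊕ Fin k) F := by
  rw [Omega2k, blocks4_submatrix, J, ← fromBlocks_one, ← fromBlocks_zero, fromBlocks_neg]
  simp only [neg_zero]
  rfl

lemma submatrix_mem_symplecticGroup_iff {A : Matrix (Fin 4 × Fin k) (Fin 4 × Fin k) F} :
    A.submatrix (blockEquiv k) (blockEquiv k) ∈ symplecticGroup (Fin k ⊕ Fin k) F ↔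
      Aᵀ * Omega2k * A = Omega2k := by
  rw [SymplecticGroup.mem_iff', ← Omega2k_submatrix, transpose_submatrix, submatrix_mul_equiv,
    submatrix_mul_equiv]
  exact Function.Injective.eq_iff (f := fun M : Matrix _ _ F => M.submatrix _ _)
    (reindex (blockEquiv k).symm (blockEquiv k).symm).injective

lemma det_eq_one_of_transpose_mul_Omega2k_mul {A : Matrix (Fin 4 × Fin k) (Fin 4 × Fin k) F}
    (hA : Aᵀ * Omega2k * A = Omega2k) : A.det = 1 := by
  rw [← det_submatrix_equiv_self (blockEquiv k)]
  exact SymplecticGroup.det_eq_one (submatrix_mem_symplecticGroup_iff.2 hA)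

lemma blocks4_mul (B C : Matrix (Fin 4) (Fin 4) (Matrix (Fin k) (Fin k) F)) :
    blocks4 B * blocks4 C = blocks4 (B * C) :=
  (map_mul (compRingEquiv (Fin 4) (Fin k) F) B C).symm

lemma Va_transpose_mul_Omega2k_mul {m : Matrix (Fin k) (Fin k) F} (hm : m.IsSymm) (l : F) :
    (Va m l)ᵀ * Omega2k * Va m l = Omega2k := by
  simp only [Va, Omega2k, blocks4_transpose, blocks4_mul, mul_fin_four, transpose_smul,
    transpose_one, transpose_zero, hm.eq, mul_zero, zero_mul, mul_one, one_mul, add_zero,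
    zero_add, mul_neg, neg_zero, add_neg_cancel]

lemma Vb_transpose_mul_Omega2k_mul {m : Matrix (Fin k) (Fin k) F} (hm : m.IsSymm) (l : F) :
    (Vb m l)ᵀ * Omega2k * Vb m l = Omega2k := by
  simp only [Vb, Omega2k, blocks4_transpose, blocks4_mul, mul_fin_four, transpose_smul,
    transpose_one, transpose_zero, transpose_neg, hm.eq, mul_zero, zero_mul, mul_one, one_mul,
    add_zero, zero_add, neg_mul, mul_neg, neg_zero, neg_neg, neg_add_cancel, add_neg_cancel]

lemma Vc_transpose_mul_Omega2k_mul {m : Matrix (Fin k) (Fin k) F} (hm : m.IsSymm) (l : F) :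
    (Vc m l)ᵀ * Omega2k * Vc m l = Omega2k := by
  simp only [Vc, Omega2k, blocks4_transpose, blocks4_mul, mul_fin_four, transpose_smul,
    transpose_one, transpose_zero, hm.eq, mul_zero, zero_mul, mul_one, one_mul, add_zero,
    zero_add, neg_mul, mul_neg, neg_zero, add_neg_cancel]

lemma transpose_mul_Omega2k_mul_of_mem_genSet {Ma Mb Mc : Matrix (Fin k) (Fin k) F}
    (ha : Ma.IsSymm) (hb : Mb.IsSymm) (hc : Mc.IsSymm)
    {g : SpecialLinearGroup (Fin 4 × Fin k) F} (hg : g ∈ genSet Ma Mb Mc) :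
    (g : Matrix (Fin 4 × Fin k) (Fin 4 × Fin k) F)ᵀ * Omega2k *
      (g : Matrix (Fin 4 × Fin k) (Fin 4 × Fin k) F) = Omega2k := by
  obtain ⟨l, h | h | h⟩ := hg <;> rw [h]
  exacts [Va_transpose_mul_Omega2k_mul ha l, Vb_transpose_mul_Omega2k_mul hb l,
    Vc_transpose_mul_Omega2k_mul hc l]

lemma transpose_mul_Omega2k_mul_of_mem_closure {Ma Mb Mc : Matrix (Fin k) (Fin k) F}
    (ha : Ma.IsSymm) (hb : Mb.IsSymm) (hc : Mc.IsSymm)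
    {g : SpecialLinearGroup (Fin 4 × Fin k) F} (hg : g ∈ Subgroup.closure (genSet Ma Mb Mc)) :
    (g : Matrix (Fin 4 × Fin k) (Fin 4 × Fin k) F)ᵀ * Omega2k *
      (g : Matrix (Fin 4 × Fin k) (Fin 4 × Fin k) F) = Omega2k := by
  induction hg using Subgroup.closure_induction with
  | mem g hg => exact transpose_mul_Omega2k_mul_of_mem_genSet ha hb hc hg
  | one => simp
  | mul g h _ _ hg hh =>
    calc (g.1 * h.1)ᵀ * Omega2k * (g.1 * h.1)
        = h.1ᵀ * (g.1ᵀ * Omega2k * g.1) * h.1 := by simp only [transpose_mul, mul_assoc]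
      _ = Omega2k := by rw [hg, hh]
  | inv g _ hg =>
    have hinv : g.1 * (g⁻¹).1 = 1 := congrArg Subtype.val (mul_inv_cancel g)
    calc (g⁻¹).1ᵀ * Omega2k * (g⁻¹).1
        = (g⁻¹).1ᵀ * (g.1ᵀ * Omega2k * g.1) * (g⁻¹).1 := by rw [hg]
      _ = (g.1 * (g⁻¹).1)ᵀ * Omega2k * (g.1 * (g⁻¹).1) := by
        simp only [transpose_mul, mul_assoc]
      _ = Omega2k := by rw [hinv, transpose_one, one_mul, mul_one]

/-- A submonoid containing all block unipotent symplectic matrices contains every matrix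
preserving `Omega2k`. -/
lemma mem_of_transpose_mul_Omega2k_mul
    {H : Submonoid (Matrix (Fin 4 × Fin k) (Fin 4 × Fin k) F)}
    (hU : ∀ m n z : Matrix (Fin k) (Fin k) F, m.IsSymm → n.IsSymm →
      blocks4 !![1, 0, m, z; 0, 1, zᵀ, n; 0, 0, 1, 0; 0, 0, 0, 1] ∈ H)
    (hL : ∀ m n z : Matrix (Fin k) (Fin k) F, m.IsSymm → n.IsSymm →
      blocks4 !![1, 0, 0, 0; 0, 1, 0, 0; m, zᵀ, 1, 0; z, n, 0, 1] ∈ H)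
    {A : Matrix (Fin 4 × Fin k) (Fin 4 × Fin k) F} (hA : Aᵀ * Omega2k * A = Omega2k) :
    A ∈ H := by
  let f := reindexAlgEquiv F F (blockEquiv k)
  have hf (B : Matrix (Fin 4) (Fin 4) (Matrix (Fin k) (Fin k) F)) :
      f (fromBlocks (fromBlocks (B 0 0) (B 0 1) (B 1 0) (B 1 1))
        (fromBlocks (B 0 2) (B 0 3) (B 1 2) (B 1 3))
        (fromBlocks (B 2 0) (B 2 1) (B 3 0) (B 3 1))
        (fromBlocks (B 2 2) (B 2 3) (B 3 2) (B 3 3))) = blocks4 B := by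
    rw [← blocks4_submatrix]
    simp [f]
  have hle : symplecticGroup (Fin k ⊕ Fin k) F ≤ H.comap f := by
    refine symplecticGroup_le_of_unipotent_mem (fun X hX => ?_) fun X hX => ?_
    · obtain ⟨h₁, h₂, -, h₃⟩ := isSymm_fromBlocks_iff.1 (X.fromBlocks_toBlocks.symm ▸ hX)
      have h := hU _ _ X.toBlocks₁₂ h₁ h₃
      have hblocks : (fromBlocks 1 X 0 1 : Matrix ((Fin k ⊕ Fin k) ⊕ Fin k ⊕ Fin k) ((Fin k ⊕ Fin k) ⊕ Fin k ⊕ Fin k) F) =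
          fromBlocks (fromBlocks 1 0 0 1)
          (fromBlocks X.toBlocks₁₁ X.toBlocks₁₂ X.toBlocks₁₂ᵀ X.toBlocks₂₂)
          (fromBlocks 0 0 0 0) (fromBlocks 1 0 0 1) := by
        rw [h₂, fromBlocks_toBlocks, fromBlocks_one, fromBlocks_zero]
      rw [← hf] at h
      rw [hblocks]
      exact h
    · obtain ⟨h₁, -, h₂, h₃⟩ := isSymm_fromBlocks_iff.1 (X.fromBlocks_toBlocks.symm ▸ hX)
      have h := hL _ _ X.toBlocks₂₁ h₁ h₃
      have hblocks : (fromBlocks 1 0 X 1 : Matrix ((Fin k ⊕ Fin k) ⊕ Fin k ⊕ Fin k) ((Fin k ⊕ Fin k) ⊕ Fin k ⊕ Fin k) F) =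
          fromBlocks (fromBlocks 1 0 0 1)
          (fromBlocks 0 0 0 0)
          (fromBlocks X.toBlocks₁₁ X.toBlocks₂₁ᵀ X.toBlocks₂₁ X.toBlocks₂₂)
          (fromBlocks 1 0 0 1) := by
        rw [h₂, fromBlocks_toBlocks, fromBlocks_one, fromBlocks_zero]
      rw [← hf] at h
      rw [hblocks]
      exact h
  have := hle (submatrix_mem_symplecticGroup_iff.2 hA)
  simpa [f] using this

end Blocks

theorem stmt16 (p k r q : ℕ) (hp : p.Prime) (hk : k.Prime) (hp2 : 2 < p) (hk3 : 3 < k)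
    (hpk : p ≠ k) (hr : 1 ≤ r) (hq : q = p ^ r) (hq3 : 3 < q)
    (F : Type) [Field F] [Fintype F] (hF : Fintype.card F = q)
    (Ma Mb S : Matrix (Fin k) (Fin k) F)
    (hMaS : Ma.IsSymm) (hMbS : Mb.IsSymm) (hMa : IsUnit Ma) (hMb : IsUnit Mb)
    (hSsymm : S.IsSymm) (hSunit : IsUnit S) (hSord : orderOf S = q ^ k - 1)
    (hscal : ∃ c : F, c ≠ 0 ∧ Ma * Mb + Mb * Ma = c • (1 : Matrix (Fin k) (Fin k) F))
    (hpow : ¬ ∃ n : ℕ, Ma * Mb * S * Mb * Ma = S ^ n)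
    (Mc : Matrix (Fin k) (Fin k) F) (hMc : Mc = (Ma * Mb + Mb * Ma)⁻¹ * S) :
    (fun g : Matrix.SpecialLinearGroup (Fin 4 × Fin k) F =>
        (g : Matrix (Fin 4 × Fin k) (Fin 4 × Fin k) F)) ''
      (Subgroup.closure (genSet Ma Mb Mc) : Set (Matrix.SpecialLinearGroup (Fin 4 × Fin k) F)) =
    {A : Matrix (Fin 4 × Fin k) (Fin 4 × Fin k) F |
      IsUnit A ∧ Aᵀ * Omega2k * A = Omega2k} := by
  obtain ⟨c, hc0, hc⟩ := hscal
  have hMcS : Mc = c⁻¹ • S := by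
    rw [hMc, hc, inv_eq_right_inv (B := c⁻¹ • 1) (by simp [smul_smul, hc0]), smul_mul_assoc,
      one_mul]
  have hMcsymm : Mc.IsSymm := by
    rw [hMcS]
    exact hSsymm.smul _
  have h2 : (2 : F) ≠ 0 := by
    intro h
    obtain ⟨m, hm⟩ : Odd q := hq ▸ (hp.odd_of_ne_two hp2.ne').pow
    have hcard := FiniteField.cast_card_eq_zero F
    rw [hF, hm] at hcard
    simp [h] at hcard
  ext A
  constructor
  · rintro ⟨g, hg, rfl⟩
    exact ⟨(isUnit_iff_isUnit_det _).2 (by simp),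
      transpose_mul_Omega2k_mul_of_mem_closure hMaS hMbS hMcsymm hg⟩
  · rintro ⟨-, hA⟩
    let H := (Subgroup.closure (genSet Ma Mb Mc)).toSubmonoid.map SpecialLinearGroup.coeMonoidHom
    let G := H.comap (compRingEquiv (Fin 4) (Fin k) F)
    have hgen : ∀ B : Matrix (Fin 4 × Fin k) (Fin 4 × Fin k) F, Bᵀ * Omega2k * B = Omega2k →
        (∃ l, B = Va Ma l ∨ B = Vb Mb l ∨ B = Vc Mc l) → B ∈ H := fun B hB h =>
      ⟨⟨B, det_eq_one_of_transpose_mul_Omega2k_mul hB⟩, Subgroup.subset_closure h, rfl⟩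
    have haZ : Ma ∈ rootSpace F G homZ := fun l => by
      have := hgen _ (Va_transpose_mul_Omega2k_mul hMaS l) ⟨l, .inl rfl⟩
      have h : homZ (.ofAdd (l • Ma)) = rootZ (l • Ma) (l • Ma) :=
        congrArg (rootZ (l • Ma)) (hMaS.smul l).eq
      rw [h]
      exact this
    have hbY : Mb ∈ rootSpace F G homY := fun l => by
      have := hgen _ (Vb_transpose_mul_Omega2k_mul hMbS l) ⟨l, .inr (.inl rfl)⟩
      have h : homY (.ofAdd (l • Mb)) = rootY (l • Mb) (l • Mb) :=
        congrArg (rootY (l • Mb)) (hMbS.smul l).eq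
      rw [h]
      exact this
    have hcQ : Mc ∈ rootSpace F G homQ := fun l =>
      hgen _ (Vc_transpose_mul_Omega2k_mul hMcsymm l) ⟨l, .inr (.inr rfl)⟩
    rw [hMcS, Submodule.smul_mem_iff _ (inv_ne_zero hc0)] at hcQ
    obtain ⟨hX, hY, hZ, hW⟩ := rootSpace_eq_top h2 hk hSunit hSsymm (by rw [hSord, hF]) hc0
      hMaS hMbS hMa hMb hc hpow haZ hbY hcQ
    exact mem_of_transpose_mul_Omega2k_mul (H := H)
      (fun m n z hm hn => upper_mem h2 hX hY hZ hm hn z)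
      (fun m n z hm hn => lower_mem h2 hX hY hW hm hn z) hA
end

section
/- Let p > 2 and k > 3 be distinct primes and let q = p^r > 3 for some r ≥ 1. Define M_a ∈ GL_k(F_q) as the block-diagonal matrix with upper-left 2×2 block diag(−1, 1) and lower-right block −I_{k−2}, and M_b ∈ GL_k(F_q) as the block-diagonal matrix with upper-left 2×2 block ((1, −1), (−1, −1)) and lower-right block I_{k−2}. Then M_a and M_b are symmetric invertible matrices, M_a M_b + M_b M_a = −2·I_k, and for every symmetric matrix S ∈ GL_k(F_q) of order q^k − 1, the matrix M_a M_b S M_b M_a does not commute with S (in particular it is not a power of S). -/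
open Matrix

/-- The matrix `M_a = diag(-1, 1, -1, …, -1)`. -/
def Ma17 (k : ℕ) (F : Type*) [Field F] : Matrix (Fin k) (Fin k) F :=
  Matrix.diagonal fun i => if (i : ℕ) = 1 then 1 else -1

/-- The matrix `M_b`, block diagonal with upper-left `2 × 2` block `((1, -1), (-1, -1))` and
lower-right block `I_{k-2}`. -/
def Mb17 (k : ℕ) (F : Type*) [Field F] : Matrix (Fin k) (Fin k) F :=
  Matrix.of fun i j =>
    if (i : ℕ) ≤ 1 ∧ (j : ℕ) ≤ 1 then (if (i : ℕ) = 0 ∧ (j : ℕ) = 0 then 1 else -1)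
    else if i = j then 1 else 0

section Singer

variable {F : Type*} [Field F] [Fintype F] {k : ℕ}

/-- Differences of powers of a Singer matrix are zero or again powers of it. -/
lemma sub_pow_eq_zero_or_pow {S : Matrix (Fin k) (Fin k) F}
    (hS : orderOf S = Fintype.card F ^ k - 1) (i j : ℕ) :
    S ^ i - S ^ j = 0 ∨ ∃ m, S ^ i - S ^ j = S ^ m := by
  classical
  by_cases hk : k = 0
  · subst hk
    exact Or.inl (Subsingleton.elim _ _)
  have : Nonempty (Fin k) := ⟨⟨0, Nat.pos_of_ne_zero hk⟩⟩
  have hpos : 0 < Fintype.card F ^ k - 1 := by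
    have := Nat.one_lt_pow hk (Fintype.one_lt_card (α := F))
    omega
  have hunit : IsUnit S := (orderOf_pos_iff.mp (hS ▸ hpos)).isUnit
  let φ : (Fin k → F) →ₗ[F] Matrix (Fin k) (Fin k) F :=
    Fintype.linearCombination F fun i : Fin k => S ^ (i : ℕ)
  have hpow (m : ℕ) : S ^ m ∈ LinearMap.range φ := by
    rw [Matrix.pow_eq_aeval_mod_charpoly]
    set f := Polynomial.X ^ m %ₘ S.charpoly
    have hdeg : f.natDegree < k := by
      have hchar : S.charpoly.natDegree = k := by simp
      refine hchar ▸ Polynomial.natDegree_modByMonic_lt _ S.charpoly_monic fun h => hk ?_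
      rw [← hchar, h, Polynomial.natDegree_one]
    refine ⟨fun i => f.coeff i, ?_⟩
    rw [Polynomial.aeval_eq_sum_range' hdeg]
    simp [φ, Fintype.linearCombination_apply, Finset.sum_range]
  let B : Finset (Matrix (Fin k) (Fin k) F) :=
    insert 0 ((Finset.range (Fintype.card F ^ k - 1)).image fun m => S ^ m)
  have hB : B.card = Fintype.card F ^ k := by
    rw [Finset.card_insert_of_notMem, Finset.card_image_of_injOn, Finset.card_range]
    · omega
    · rw [← hS]
      intro a ha b hb hab
      exact pow_injOn_Iio_orderOf (by simpa using ha) (by simpa using hb) hab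
    · simp only [Finset.mem_image, not_exists, not_and]
      exact fun m _ h => (hunit.pow m).ne_zero h
  have hsub : B ⊆ Finset.univ.image φ := by
    intro x hx
    have hx : x ∈ LinearMap.range φ := by
      simp only [B, Finset.mem_insert, Finset.mem_image] at hx
      rcases hx with rfl | ⟨m, -, rfl⟩
      · exact zero_mem _
      · exact hpow m
    simpa using hx
  have hEq : B = Finset.univ.image φ := by
    refine Finset.eq_of_subset_of_card_le hsub ?_
    rw [hB]
    exact Finset.card_image_le.trans (by simp)
  have hmem : S ^ i - S ^ j ∈ B := by
    rw [hEq]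
    simpa using sub_mem (hpow i) (hpow j)
  simp only [B, Finset.mem_insert, Finset.mem_image] at hmem
  rcases hmem with h | ⟨m, -, h⟩
  · exact Or.inl h
  · exact Or.inr ⟨m, h.symm⟩

/-- The powers of a Singer matrix act transitively on nonzero vectors. -/
lemma exists_pow_mulVec_eq {S : Matrix (Fin k) (Fin k) F}
    (hS : orderOf S = Fintype.card F ^ k - 1) {v w : Fin k → F} (hv : v ≠ 0) (hw : w ≠ 0) :
    ∃ m : ℕ, S ^ m *ᵥ v = w := by
  classical
  have hk : k ≠ 0 := by
    rintro rfl
    exact hv (Subsingleton.elim _ _)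
  have hpos : 0 < Fintype.card F ^ k - 1 := by
    have := Nat.one_lt_pow hk (Fintype.one_lt_card (α := F))
    omega
  have hunit : IsUnit S := (orderOf_pos_iff.mp (hS ▸ hpos)).isUnit
  have hne (m : ℕ) : S ^ m *ᵥ v ≠ 0 := fun h =>
    hv (Matrix.mulVec_injective_iff_isUnit.mpr (hunit.pow m) (by simpa using h))
  let B : Finset (Fin k → F) :=
    insert 0 ((Finset.range (Fintype.card F ^ k - 1)).image fun m => S ^ m *ᵥ v)
  have hB : B = Finset.univ := by
    rw [← Finset.card_eq_iff_eq_univ, Finset.card_insert_of_notMem, Finset.card_image_of_injOn,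
      Finset.card_range, Fintype.card_fun, Fintype.card_fin]
    · omega
    · rw [← hS]
      intro a ha b hb hab
      refine pow_injOn_Iio_orderOf (by simpa using ha) (by simpa using hb) ?_
      rcases sub_pow_eq_zero_or_pow hS a b with h | ⟨m, h⟩
      · exact sub_eq_zero.mp h
      · refine absurd ?_ (hne m)
        rw [← h, Matrix.sub_mulVec, sub_eq_zero]
        exact hab
    · simp only [Finset.mem_image, not_exists, not_and]
      exact fun m _ => hne m
  have hmem : w ∈ B := hB ▸ Finset.mem_univ w
  simp only [B, Finset.mem_insert, Finset.mem_image, hw, false_or] at hmem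
  obtain ⟨m, -, h⟩ := hmem
  exact ⟨m, h⟩

/-- A singular matrix commuting with a Singer matrix vanishes. -/
lemma eq_zero_of_commute_of_mulVec_eq_zero {S D : Matrix (Fin k) (Fin k) F}
    (hS : orderOf S = Fintype.card F ^ k - 1) (hD : Commute D S) {v : Fin k → F} (hv : v ≠ 0)
    (hDv : D *ᵥ v = 0) : D = 0 := by
  refine Matrix.ext_of_mulVec_single fun i => ?_
  obtain ⟨m, hm⟩ := exists_pow_mulVec_eq hS hv (w := Pi.single i 1) (by simp)
  rw [← hm, Matrix.mulVec_mulVec, (hD.pow_right m).eq, ← Matrix.mulVec_mulVec, hDv]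
  simp

end Singer

section BlockMatrices

variable {F : Type*} [Field F] {m : ℕ}

lemma Ma17_mulVec {k : ℕ} (v : Fin k → F) (i : Fin k) :
    (Ma17 k F *ᵥ v) i = if (i : ℕ) = 1 then v i else -v i := by
  simp only [Ma17, Matrix.mulVec_diagonal]
  split_ifs <;> simp

lemma Mb17_mulVec_zero (v : Fin (m + 2) → F) : (Mb17 (m + 2) F *ᵥ v) 0 = v 0 - v 1 := by
  rw [Matrix.mulVec, dotProduct, Fin.sum_univ_succ, Fin.sum_univ_succ]
  rw [Finset.sum_eq_zero fun j _ => ?_]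
  · simp [Mb17]
    ring
  · simp [Mb17, (Fin.succ_ne_zero _).symm]

lemma Mb17_mulVec_one (v : Fin (m + 2) → F) : (Mb17 (m + 2) F *ᵥ v) 1 = -v 0 - v 1 := by
  rw [Matrix.mulVec, dotProduct, Fin.sum_univ_succ, Fin.sum_univ_succ]
  rw [Finset.sum_eq_zero fun j _ => ?_]
  · simp [Mb17]
    ring
  · have h : (1 : Fin (m + 2)) ≠ j.succ.succ := fun h => by
      simpa using congrArg Fin.val h
    simp [Mb17, h]

lemma Mb17_mulVec_of_two_le {k : ℕ} (v : Fin k → F) {i : Fin k} (hi : 2 ≤ (i : ℕ)) :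
    (Mb17 k F *ᵥ v) i = v i := by
  have h : ¬ (i : ℕ) ≤ 1 := by omega
  simp [Mb17, Matrix.mulVec, dotProduct, h]

lemma Ma17_isSymm (k : ℕ) : (Ma17 k F).IsSymm := Matrix.isSymm_diagonal _

lemma Mb17_isSymm (k : ℕ) : (Mb17 k F).IsSymm := by
  ext i j
  simp only [Mb17, Matrix.transpose_apply, Matrix.of_apply, and_comm, eq_comm]

lemma isUnit_Ma17 (k : ℕ) : IsUnit (Ma17 k F) := by
  refine .of_mul_eq_one (Ma17 k F) ?_
  rw [Ma17, Matrix.diagonal_mul_diagonal, ← Matrix.diagonal_one]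
  congr 1
  ext i
  split_ifs <;> simp

lemma isUnit_Mb17 (h2 : (2 : F) ≠ 0) : IsUnit (Mb17 (m + 2) F) := by
  rw [← Matrix.mulVec_injective_iff_isUnit]
  refine (injective_iff_map_eq_zero (Matrix.mulVecLin (Mb17 (m + 2) F))).mpr fun v hv => ?_
  rw [Matrix.mulVecLin_apply] at hv
  have e0 := congrFun hv 0
  have e1 := congrFun hv 1
  rw [Mb17_mulVec_zero, Pi.zero_apply] at e0
  rw [Mb17_mulVec_one, Pi.zero_apply] at e1
  have hv1 : v 1 = 0 := (mul_eq_zero_iff_left h2).mp (by linear_combination -e0 - e1)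
  have hv0 : v 0 = 0 := by linear_combination e0 + hv1
  ext i
  refine Fin.cases hv0 (Fin.cases hv1 fun j => ?_) i
  have := congrFun hv j.succ.succ
  rwa [Mb17_mulVec_of_two_le _ (by simp)] at this

lemma Ma17_anticommute_Mb17 (k : ℕ) :
    Ma17 k F * Mb17 k F + Mb17 k F * Ma17 k F = (-2 : F) • (1 : Matrix (Fin k) (Fin k) F) := by
  ext i j
  simp only [Ma17, Mb17, Matrix.add_apply, Matrix.diagonal_mul, Matrix.mul_diagonal,
    Matrix.of_apply, Matrix.smul_apply, Matrix.one_apply, smul_eq_mul, Fin.ext_iff]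
  split_ifs <;> first | omega | ring

/-- A matrix agrees on some nonzero vector with its conjugate by `M_a M_b`. -/
lemma exists_conj_mulVec_eq (hm : 3 ≤ m) (S : Matrix (Fin (m + 2)) (Fin (m + 2)) F) :
    ∃ v ≠ 0, (Ma17 (m + 2) F * Mb17 (m + 2) F * S * Mb17 (m + 2) F * Ma17 (m + 2) F) *ᵥ v
      = S *ᵥ v := by
  let ψ : (Fin (m + 2) → F) →ₗ[F] (F × F) × (F × F) :=
    ((LinearMap.proj 0).prod (LinearMap.proj 1)).prod
      ((LinearMap.proj 0 ∘ₗ S.mulVecLin).prod (LinearMap.proj 1 ∘ₗ S.mulVecLin))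
  have hker : LinearMap.ker ψ ≠ ⊥ := LinearMap.ker_ne_bot_of_finrank_lt (by simp; omega)
  obtain ⟨v, hv, hv0⟩ := Submodule.exists_mem_ne_zero_of_ne_bot hker
  have hψ : ψ v = ((v 0, v 1), ((S *ᵥ v) 0, (S *ᵥ v) 1)) := rfl
  rw [LinearMap.mem_ker, hψ] at hv
  simp only [Prod.mk_eq_zero] at hv
  obtain ⟨⟨h0, h1⟩, h2, h3⟩ := hv
  have hb (u : Fin (m + 2) → F) (hu0 : u 0 = 0) (hu1 : u 1 = 0) : Mb17 (m + 2) F *ᵥ u = u := by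
    ext i
    refine Fin.cases ?_ (Fin.cases ?_ fun j => ?_) i
    · simp [Mb17_mulVec_zero, hu0, hu1]
    · simp [Mb17_mulVec_one, hu0, hu1]
    · exact Mb17_mulVec_of_two_le _ (by simp)
  have ha (u : Fin (m + 2) → F) (hu1 : u 1 = 0) : Ma17 (m + 2) F *ᵥ u = -u := by
    ext i
    rw [Ma17_mulVec]
    split_ifs with h
    · obtain rfl : i = 1 := Fin.ext h
      simp [hu1]
    · rfl
  refine ⟨v, hv0, ?_⟩
  simp only [← Matrix.mulVec_mulVec]
  rw [ha v h1, Matrix.mulVec_neg, hb v h0 h1, Matrix.mulVec_neg, Matrix.mulVec_neg,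
    Matrix.mulVec_neg, hb _ h2 h3, ha _ h3, neg_neg]

/-- A matrix fixed under conjugation by `M_a M_b` has vanishing lower-left block. -/
lemma lower_left_eq_zero_of_conj_eq {S : Matrix (Fin (m + 2)) (Fin (m + 2)) F}
    (hS : Ma17 (m + 2) F * Mb17 (m + 2) F * S * Mb17 (m + 2) F * Ma17 (m + 2) F = S)
    {i : Fin (m + 2)} (hi : 2 ≤ (i : ℕ)) : S i 0 = 0 ∧ S i 1 = 0 := by
  have hrow (v : Fin (m + 2) → F) :
      (S *ᵥ v) i = -(S *ᵥ (Mb17 (m + 2) F *ᵥ (Ma17 (m + 2) F *ᵥ v))) i := by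
    conv_lhs => rw [← hS]
    simp only [← Matrix.mulVec_mulVec]
    rw [Ma17_mulVec, if_neg (by omega), Mb17_mulVec_of_two_le _ hi]
  have hvec (v : Fin (m + 2) → F) (hv : ∀ j : Fin m, v j.succ.succ = 0) :
      Mb17 (m + 2) F *ᵥ (Ma17 (m + 2) F *ᵥ v) =
        Pi.single 0 (-v 0 - v 1) + Pi.single 1 (v 0 - v 1) := by
    ext j
    refine Fin.cases ?_ (Fin.cases ?_ fun j => ?_) j
    · simp [Mb17_mulVec_zero, Ma17_mulVec]
    · simp [Mb17_mulVec_one, Ma17_mulVec]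
    · rw [Mb17_mulVec_of_two_le _ (by simp), Ma17_mulVec, if_neg (by simp), hv]
      simp [Fin.ext_iff]
  have e0 := hrow (Pi.single 0 1)
  have e1 := hrow (Pi.single 1 1)
  rw [hvec _ fun j => by simp [Fin.ext_iff]] at e0 e1
  simp [Matrix.mulVec_add, Matrix.mulVec_single] at e0 e1
  exact ⟨e1, e0⟩

end BlockMatrices

/-- A symmetric Singer matrix does not commute with its conjugate by `M_a M_b`. -/
lemma not_commute_conj {F : Type*} [Field F] [Fintype F] {m : ℕ} (hm : 3 ≤ m)
    {S : Matrix (Fin (m + 2)) (Fin (m + 2)) F} (hsymm : S.IsSymm)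
    (hS : orderOf S = Fintype.card F ^ (m + 2) - 1) :
    ¬ Commute (Ma17 (m + 2) F * Mb17 (m + 2) F * S * Mb17 (m + 2) F * Ma17 (m + 2) F) S := by
  intro hcomm
  obtain ⟨v, hv, hSv⟩ := exists_conj_mulVec_eq hm S
  have hfix := sub_eq_zero.mp <| eq_zero_of_commute_of_mulVec_eq_zero hS
    (hcomm.sub_left (Commute.refl S)) hv (by rw [Matrix.sub_mulVec, hSv, sub_self])
  let P : Matrix (Fin (m + 2)) (Fin (m + 2)) F :=
    Matrix.diagonal fun i => if (i : ℕ) ≤ 1 then 1 else 0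
  have hlow {i j : Fin (m + 2)} (hi : ¬ (i : ℕ) ≤ 1) (hj : (j : ℕ) ≤ 1) : S i j = 0 := by
    obtain ⟨h0, h1⟩ := lower_left_eq_zero_of_conj_eq hfix (i := i) (by omega)
    rcases Nat.le_one_iff_eq_zero_or_eq_one.mp hj with h | h
    · rwa [show j = 0 from Fin.ext h]
    · rwa [show j = 1 from Fin.ext h]
  have hP : Commute P S := by
    ext i j
    simp only [P, Matrix.diagonal_mul, Matrix.mul_diagonal]
    split_ifs with hi hj hj
    · ring
    · rw [← hsymm.apply i j, hlow hj hi]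
      ring
    · rw [hlow hi hj]
      ring
    · ring
  have hP0 : P = 0 := eq_zero_of_commute_of_mulVec_eq_zero hS hP
    (v := Pi.single ⟨2, by omega⟩ 1) (by simp) (by ext i; simp [P])
  have := congrFun (congrFun hP0 0) 0
  simp [P] at this

theorem stmt17 (p k r q : ℕ) (hp : p.Prime) (hk : k.Prime) (hp2 : 2 < p) (hk3 : 3 < k)
    (hpk : p ≠ k) (hr : 1 ≤ r) (hq : q = p ^ r) (hq3 : 3 < q)
    (F : Type) [Field F] [Fintype F] (hF : Fintype.card F = q) :
    (Ma17 k F).IsSymm ∧ (Mb17 k F).IsSymm ∧ IsUnit (Ma17 k F) ∧ IsUnit (Mb17 k F) ∧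
    Ma17 k F * Mb17 k F + Mb17 k F * Ma17 k F = (-2 : F) • (1 : Matrix (Fin k) (Fin k) F) ∧
    ∀ S : Matrix (Fin k) (Fin k) F, S.IsSymm → IsUnit S → orderOf S = q ^ k - 1 →
      (Ma17 k F * Mb17 k F * S * Mb17 k F * Ma17 k F) * S ≠
        S * (Ma17 k F * Mb17 k F * S * Mb17 k F * Ma17 k F) ∧
      ¬ ∃ n : ℕ, Ma17 k F * Mb17 k F * S * Mb17 k F * Ma17 k F = S ^ n := by
  have hk5 : 5 ≤ k := by
    by_contra h
    obtain rfl : k = 4 := by omega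
    norm_num at hk
  obtain ⟨m, rfl⟩ : ∃ m, k = m + 2 := ⟨k - 2, by omega⟩
  have h2 : (2 : F) ≠ 0 := by
    refine Ring.two_ne_zero fun h => ?_
    rw [FiniteField.even_card_iff_char_two, hF, hq] at h
    have hodd : Odd (p ^ r) := (hp.odd_of_ne_two (by omega)).pow
    rw [Nat.odd_iff] at hodd
    omega
  refine ⟨Ma17_isSymm _, Mb17_isSymm _, isUnit_Ma17 _, isUnit_Mb17 h2, Ma17_anticommute_Mb17 _,
    fun S hsymm _ hS => ?_⟩
  have hnot := not_commute_conj (m := m) (by omega) hsymm (hF ▸ hS)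
  refine ⟨hnot, ?_⟩
  rintro ⟨n, hn⟩
  exact hnot (hn ▸ (Commute.refl S).pow_left n)
end
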